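/- arXiv:0709.0715 — 2 statements merged into one kernel-verified Lean document; each statement's English description precedes it below -/
import Mathlib

section
/- Let k = F_q be the field with q elements (q a power of a prime p), n ≥ 2, and V = k^{2n}. Let G_n ≤ GL_{2n}(k) be the group of block matrices [[I,O],[B,I]] where B is a symmetric n×n matrix over k (B = Bᵀ). Then the action of G_n on V is not coregular and does not have the direct summand property. -/
open MvPolynomial Matrix

set_option synthInstance.maxHeartbeats 1000000
set_option maxHeartbeats 1000000

variable {k : Type} [Field k] {ι : Type} [Fintype ι] [DecidableEq ι]

/-- Substitution of the variables by the linear forms determined by the matrix `g`. -/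
noncomputable def polySub (g : Matrix ι ι k) :
    MvPolynomial ι k →ₐ[k] MvPolynomial ι k :=
  aeval fun i => ∑ j, C (g i j) * X j

/-- The (left) action of an invertible matrix `g` on polynomial functions,
`(g • f)(v) = f (g⁻¹ *ᵥ v)`. -/
noncomputable def polyAct (g : Matrix ι ι k) :
    MvPolynomial ι k →ₐ[k] MvPolynomial ι k :=
  polySub g⁻¹

/-- The ring of invariants of a set of (invertible) matrices. -/
noncomputable def invariantRing (S : Set (Matrix ι ι k)) :
    Subalgebra k (MvPolynomial ι k) :=
  ⨅ g ∈ S, AlgHom.equalizer (polyAct g) (AlgHom.id k _)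

/-- The direct summand property: there is a surjective `k[V]^G`-linear map
`k[V] → k[V]^G` respecting the gradings. -/
noncomputable def DirectSummand (S : Set (Matrix ι ι k)) : Prop :=
  ∃ π : MvPolynomial ι k →ₗ[invariantRing S] invariantRing S,
    Function.Surjective π ∧
    ∀ (d : ℕ) (f : MvPolynomial ι k),
      f.IsHomogeneous d → ((π f : MvPolynomial ι k)).IsHomogeneous d

/-- Coregularity: the invariant ring is generated by `dim V` algebraically
independent homogeneous invariants. -/
noncomputable def Coregular (S : Set (Matrix ι ι k)) : Prop :=
  ∃ f : ι → MvPolynomial ι k,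
    (∀ i, ∃ d, (f i).IsHomogeneous d) ∧
    AlgebraicIndependent k f ∧
    Algebra.adjoin k (Set.range f) = invariantRing S

/-- A pseudo-reflection: fixed-point space of codimension one. -/
def IsPseudoReflection (g : Matrix ι ι k) : Prop :=
  Module.finrank k (LinearMap.ker (g.mulVecLin - LinearMap.id)) + 1 = Fintype.card ι

/-- The set of matrices underlying a subgroup of `GL`. -/
def matSet {n : ℕ} (G : Subgroup (GL (Fin n) k)) : Set (Matrix (Fin n) (Fin n) k) :=
  (fun g : GL (Fin n) k => (g : Matrix (Fin n) (Fin n) k)) '' (G : Set (GL (Fin n) k))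

/-- The point stabilizer of a subspace `U`. -/
def pointStabilizer {n : ℕ} (G : Subgroup (GL (Fin n) k)) (U : Submodule k (Fin n → k)) :
    Subgroup (GL (Fin n) k) where
  carrier := {g | g ∈ G ∧ ∀ u ∈ U, (g : Matrix (Fin n) (Fin n) k) *ᵥ u = u}
  one_mem' := ⟨G.one_mem, fun u _ => by simp⟩
  mul_mem' := fun {a b} ha hb => ⟨G.mul_mem ha.1 hb.1, fun u hu => by
    have h1 := ha.2 u hu
    have h2 := hb.2 u hu
    rw [Units.val_mul, ← Matrix.mulVec_mulVec, h2, h1]⟩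
  inv_mem' := fun {a} ha => ⟨G.inv_mem ha.1, fun u hu => by
    conv_lhs => rw [← ha.2 u hu]
    rw [Matrix.mulVec_mulVec, Units.inv_mul, Matrix.one_mulVec]⟩

/-- The group of block matrices `[[I,O],[B,I]]` with `B` symmetric, viewed as a
set of `2n × 2n` matrices over `k = F_q`. -/
def symmetricTransvections (n : ℕ) (k : Type) [Field k] :
    Set (Matrix (Fin n ⊕ Fin n) (Fin n ⊕ Fin n) k) :=
  {M | ∃ B : Matrix (Fin n) (Fin n) k,
    B = B.transpose ∧ M = Matrix.fromBlocks 1 0 B 1}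

theorem aeval_comp_polySub {A : Type*} [CommRing A] [Algebra k A] (g : Matrix ι ι k) (v : ι → A)
    (f : MvPolynomial ι k) :
    aeval v (polySub g f) = aeval (fun i => ∑ j, g i j • v j) f := by
  rw [polySub, comp_aeval_apply]
  simp [Algebra.smul_def]

theorem isHomogeneous_polySub (g : Matrix ι ι k) {f : MvPolynomial ι k} {d : ℕ}
    (hf : f.IsHomogeneous d) : (polySub g f).IsHomogeneous d := by
  have := hf.aeval (fun i => ∑ j, C (g i j) * X j) (n := 1)
    (fun i => IsHomogeneous.sum _ _ _ fun j _ => isHomogeneous_C_mul_X _ _)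
  simpa [polySub] using this

theorem homogeneousComponent_polySub (g : Matrix ι ι k) (d : ℕ) (f : MvPolynomial ι k) :
    homogeneousComponent d (polySub g f) = polySub g (homogeneousComponent d f) := by
  conv_lhs => rw [← sum_homogeneousComponent f]
  rw [map_sum, map_sum]
  have h (i : ℕ) : homogeneousComponent d (polySub g (homogeneousComponent i f)) =
      if i = d then polySub g (homogeneousComponent d f) else 0 := by
    rw [homogeneousComponent_of_mem
      (isHomogeneous_polySub g (homogeneousComponent_isHomogeneous i f))]
    split_ifs <;> simp_all
  simp only [h, Finset.sum_ite_eq', Finset.mem_range]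
  split_ifs with hd
  · rfl
  · rw [homogeneousComponent_eq_zero d f (by omega), map_zero]

theorem homogeneousComponent_mem_invariantRing {S : Set (Matrix ι ι k)} {f : MvPolynomial ι k}
    (hf : f ∈ invariantRing S) (d : ℕ) : homogeneousComponent d f ∈ invariantRing S := by
  simp only [invariantRing, Algebra.mem_iInf, AlgHom.mem_equalizer, AlgHom.coe_id, id_eq,
    polyAct] at hf ⊢
  intro g hg
  rw [← homogeneousComponent_polySub, hf g hg]

theorem mem_invariantRing_symmetricTransvections {n : ℕ}
    {f : MvPolynomial (Fin n ⊕ Fin n) k} :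
    f ∈ invariantRing (symmetricTransvections n k) ↔
      ∀ B : Matrix (Fin n) (Fin n) k, B.IsSymm → polySub (fromBlocks 1 0 B 1) f = f := by
  have hinv (B : Matrix (Fin n) (Fin n) k) :
      (fromBlocks 1 0 B 1 : Matrix (Fin n ⊕ Fin n) (Fin n ⊕ Fin n) k)⁻¹ =
        fromBlocks 1 0 (-B) 1 := by
    apply Matrix.inv_eq_right_inv
    simp [fromBlocks_multiply]
  simp only [invariantRing, Algebra.mem_iInf, AlgHom.mem_equalizer, AlgHom.coe_id, id_eq,
    polyAct, symmetricTransvections, Set.mem_ofPred_eq]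
  constructor
  · intro h B hB
    have := h _ ⟨-B, by rw [transpose_neg, hB.eq], rfl⟩
    rwa [hinv, neg_neg] at this
  · rintro h _ ⟨B, hB, rfl⟩
    rw [hinv]
    exact h _ (by rw [IsSymm, transpose_neg, ← hB])

/-- Invariants take the same value at `(x, y)` and at `(x, y + B x)`, in every `k`-algebra. -/
theorem aeval_shear_of_mem_invariantRing {n : ℕ} {f : MvPolynomial (Fin n ⊕ Fin n) k}
    (hf : f ∈ invariantRing (symmetricTransvections n k)) {A : Type*} [CommRing A] [Algebra k A]
    (x y : Fin n → A) {B : Matrix (Fin n) (Fin n) k} (hB : B.IsSymm) :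
    aeval (Sum.elim x fun i => y i + ∑ j, B i j • x j) f = aeval (Sum.elim x y) f := by
  conv_rhs => rw [← mem_invariantRing_symmetricTransvections.mp hf B hB]
  rw [aeval_comp_polySub]
  congr 2
  ext (i | i) <;> simp [Fintype.sum_sum_type, Matrix.one_apply, ite_smul, add_comm]

theorem X_inl_mem_invariantRing {n : ℕ} (i : Fin n) :
    (X (Sum.inl i) : MvPolynomial (Fin n ⊕ Fin n) k) ∈
      invariantRing (symmetricTransvections n k) := by
  rw [mem_invariantRing_symmetricTransvections]
  intro B _
  simp [polySub, Fintype.sum_sum_type, Matrix.one_apply]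

/-- The symplectic pairing of the generic point `(x, y)` with its Frobenius twist. -/
noncomputable def frobeniusPairing (n : ℕ) (k : Type) [Field k] [Fintype k] :
    MvPolynomial (Fin n ⊕ Fin n) k :=
  ∑ i, X (Sum.inl i) * (X (Sum.inl i) ^ (Fintype.card k - 1) * X (Sum.inr i) -
    X (Sum.inr i) ^ Fintype.card k)

theorem frobeniusPairing_mem_invariantRing (n : ℕ) [Fintype k] :
    frobeniusPairing n k ∈ invariantRing (symmetricTransvections n k) := by
  rw [mem_invariantRing_symmetricTransvections]
  intro B hB
  have hfrob (i : Fin n) : (∑ j, C (B i j) * X (Sum.inl j) + X (Sum.inr i) :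
      MvPolynomial (Fin n ⊕ Fin n) k) ^ Fintype.card k =
      ∑ j, C (B i j) * X (Sum.inl j) ^ Fintype.card k + X (Sum.inr i) ^ Fintype.card k := by
    have := map_add (FiniteField.frobeniusAlgHom k (MvPolynomial (Fin n ⊕ Fin n) k))
      (∑ j, C (B i j) * X (Sum.inl j)) (X (Sum.inr i))
    simpa [map_sum, map_mul, mul_pow, ← C_pow, FiniteField.pow_card] using this
  have hpow (a : MvPolynomial (Fin n ⊕ Fin n) k) :
      a * a ^ (Fintype.card k - 1) = a ^ Fintype.card k := mul_pow_sub_one Fintype.card_ne_zero a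
  have hsymm : ∑ i, ∑ j, X (Sum.inl i) ^ Fintype.card k * (C (B i j) * X (Sum.inl j)) =
      ∑ i, ∑ j, X (Sum.inl i) * (C (B i j) * X (Sum.inl j) ^ Fintype.card k :
        MvPolynomial (Fin n ⊕ Fin n) k) := by
    rw [Finset.sum_comm]
    refine Finset.sum_congr rfl fun i _ => Finset.sum_congr rfl fun j _ => ?_
    rw [hB.apply]
    ring
  have hl (i : Fin n) : polySub (fromBlocks 1 0 B 1) (X (Sum.inl i)) = X (Sum.inl i) := by
    simp [polySub, Fintype.sum_sum_type, Matrix.one_apply]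
  have hr (i : Fin n) : polySub (fromBlocks 1 0 B 1) (X (Sum.inr i)) =
      ∑ j, C (B i j) * X (Sum.inl j) + X (Sum.inr i) := by
    simp [polySub, Fintype.sum_sum_type, Matrix.one_apply]
  simp only [frobeniusPairing, map_sum, map_mul, map_sub, map_pow, hl, hr, hfrob]
  simp only [mul_sub, ← mul_assoc, hpow]
  simp only [mul_add, Finset.mul_sum, Finset.sum_sub_distrib, Finset.sum_add_distrib, hsymm]
  ring

theorem natDegree_aeval_le_of_isHomogeneous {σ A : Type*} [CommRing A]
    [Algebra k A] {c : MvPolynomial σ k} {q : ℕ} (hc : c.IsHomogeneous q) (v : σ → Polynomial A)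
    (hv : ∀ i, (v i).natDegree ≤ 1) : (aeval v c).natDegree ≤ q := by
  rw [aeval_def, eval₂_eq]
  refine Polynomial.natDegree_sum_le_of_forall_le _ _ fun m hm => ?_
  refine (Polynomial.natDegree_mul_le).trans ?_
  have h1 : (algebraMap k (Polynomial A) (coeff m c)).natDegree = 0 := by
    rw [Polynomial.algebraMap_apply, Polynomial.natDegree_C]
  rw [h1, zero_add, hc.degree_eq_sum_deg_support hm]
  refine (Polynomial.natDegree_prod_le _ _).trans (Finset.sum_le_sum fun i _ => ?_)
  exact Polynomial.natDegree_pow_le.trans (by nlinarith [hv i])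

theorem coeff_aeval_of_isHomogeneous {σ A : Type*} [CommRing A]
    [Algebra k A] {c : MvPolynomial σ k} {q : ℕ} (hc : c.IsHomogeneous q) (v : σ → Polynomial A)
    (i₀ : σ) (hv₀ : v i₀ = Polynomial.X) (hv : ∀ i ≠ i₀, (v i).natDegree = 0) :
    (aeval v c).coeff q = algebraMap k A (coeff (Finsupp.single i₀ q) c) := by
  classical
  rw [aeval_def, eval₂_eq, Polynomial.finsetSum_coeff,
    Finset.sum_eq_single (Finsupp.single i₀ q)]
  · rw [Polynomial.algebraMap_apply, Polynomial.coeff_C_mul]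
    rcases eq_or_ne q 0 with rfl | hq
    · simp
    · simp [Finsupp.support_single, hq, hv₀]
  · intro m hm hne
    rw [Polynomial.algebraMap_apply, Polynomial.coeff_C_mul,
      Polynomial.coeff_eq_zero_of_natDegree_lt, mul_zero]
    have hdeg : q = ∑ i ∈ m.support, m i := hc.degree_eq_sum_deg_support hm
    have hlt : m i₀ < q := by
      by_contra! hle
      apply hne
      have hqm : m i₀ + ∑ i ∈ m.support.erase i₀, m i = q := by
        rw [hdeg]
        by_cases h : i₀ ∈ m.support
        · exact Finset.add_sum_erase _ _ h
        · rw [Finset.erase_eq_of_notMem h, Finsupp.notMem_support_iff.mp h, zero_add]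
      ext i
      rcases eq_or_ne i i₀ with rfl | hi
      · simp; omega
      · rw [Finsupp.single_eq_of_ne hi]
        have h0 : ∑ i ∈ m.support.erase i₀, m i = 0 := by omega
        by_cases h : i ∈ m.support
        · exact Finset.sum_eq_zero_iff.mp h0 i (Finset.mem_erase.mpr ⟨hi, h⟩)
        · exact Finsupp.notMem_support_iff.mp h
    refine lt_of_le_of_lt ((Polynomial.natDegree_prod_le _ _).trans ?_) hlt
    calc ∑ i ∈ m.support, (v i ^ m i).natDegree
        ≤ ∑ i ∈ m.support, if i = i₀ then m i₀ else 0 := by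
          refine Finset.sum_le_sum fun i _ => Polynomial.natDegree_pow_le.trans ?_
          split_ifs with h
          · subst h
            rw [hv₀]
            exact (Nat.mul_le_mul_left _ Polynomial.natDegree_X_le).trans (by simp)
          · rw [hv i h, mul_zero]
      _ ≤ m i₀ := by
          rw [Finset.sum_ite_eq']
          split_ifs <;> simp
  · intro h
    rw [notMem_support_iff.mp h, map_zero, zero_mul, Polynomial.coeff_zero]

/-- A polynomial of degree at most `|k|` that is constant along `k • u` is determined by its
constant term and its coefficient in degree `|k|`. -/
theorem eval_eq_of_eval_smul_eq [Fintype k] {A : Type*} [CommRing A] [IsDomain A] [Algebra k A]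
    {u : A} (hu : u ≠ 0) {h : Polynomial A} (hdeg : h.natDegree ≤ Fintype.card k)
    (hh : ∀ a : k, h.eval (a • u) = h.eval 0) (t : A) :
    h.eval t = h.eval 0 + h.coeff (Fintype.card k) * ∏ a : k, (t - a • u) := by
  set P : Polynomial A := ∏ a : k, (Polynomial.X - Polynomial.C (a • u)) with hP
  have hPmonic : P.Monic := Polynomial.monic_prod_of_monic _ _ fun a _ => Polynomial.monic_X_sub_C _
  have hPdeg : P.natDegree = Fintype.card k := by
    rw [hP, Polynomial.natDegree_prod_of_monic _ _ fun a _ => Polynomial.monic_X_sub_C _]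
    simp
  have hq : 0 < Fintype.card k := Fintype.card_pos
  have hPeval (s : A) : P.eval s = ∏ a : k, (s - a • u) := by
    simp [hP, Polynomial.eval_prod]
  set F : Polynomial A :=
    h - Polynomial.C (h.eval 0) - Polynomial.C (h.coeff (Fintype.card k)) * P with hF
  have hFle : F.natDegree ≤ Fintype.card k := by
    refine (Polynomial.natDegree_sub_le _ _).trans (max_le ?_ ?_)
    · exact (Polynomial.natDegree_sub_C (a := h.eval 0)).trans_le hdeg
    · exact (Polynomial.natDegree_C_mul_le _ _).trans hPdeg.le
  have hFcoeff : F.coeff (Fintype.card k) = 0 := by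
    have : P.coeff (Fintype.card k) = 1 := by rw [← hPdeg]; exact hPmonic
    simp [hF, this, Polynomial.coeff_C, hq.ne']
  have hFlt : F.natDegree < Fintype.card k := by
    refine lt_of_le_of_ne hFle fun heq => ?_
    have : F = 0 := by
      rw [← Polynomial.leadingCoeff_eq_zero, Polynomial.leadingCoeff, heq, hFcoeff]
    rw [this, Polynomial.natDegree_zero] at heq
    omega
  have hF0 : F = 0 := by
    refine Polynomial.eq_zero_of_natDegree_lt_card_of_eval_eq_zero F (f := fun a : k => a • u)
      (smul_left_injective k hu) (fun a => ?_) hFlt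
    rw [hF]
    simp only [Polynomial.eval_sub, Polynomial.eval_mul, Polynomial.eval_C, hPeval, hh]
    rw [Finset.prod_eq_zero (Finset.mem_univ a) (sub_self (a • u)), mul_zero, sub_self, sub_zero]
  have := congrArg (Polynomial.eval t) hF0
  simp only [hF, Polynomial.eval_sub, Polynomial.eval_mul, Polynomial.eval_C, hPeval,
    Polynomial.eval_zero] at this
  linear_combination this

theorem coeff_single_inr_eq_zero_of_isHomogeneous [Fintype k] {n : ℕ} {i₀ i₁ : Fin n}
    (hne : i₀ ≠ i₁) {c : MvPolynomial (Fin n ⊕ Fin n) k}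
    (hc : c ∈ invariantRing (symmetricTransvections n k))
    (hhom : c.IsHomogeneous (Fintype.card k)) :
    coeff (Finsupp.single (Sum.inr i₀) (Fintype.card k)) c = 0 := by
  let A := Polynomial (Polynomial k)
  let u : A := Polynomial.X
  let t : A := Polynomial.C Polynomial.X
  let x : Fin n → A := Pi.single i₀ u + Pi.single i₁ t
  let y (s : A) : Fin n → A := Pi.single i₀ s + Pi.single i₁ u
  let v : Fin n ⊕ Fin n → Polynomial A := Sum.elim (fun i => Polynomial.C (x i))
    (Pi.single i₀ Polynomial.X + Pi.single i₁ (Polynomial.C u))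
  have hveval (s : A) : (aeval v c).eval s = aeval (Sum.elim x (y s)) c := by
    have := comp_aeval_apply (Polynomial.aeval s |>.restrictScalars k) (f := v) c
    rw [AlgHom.restrictScalars_apply, Polynomial.coe_aeval_eq_eval] at this
    rw [this]
    congr 2
    ext (i | i) : 1
    · simp [v]
    · rcases eq_or_ne i i₀ with rfl | h0
      · simp [v, y, hne]
      · rcases eq_or_ne i i₁ with rfl | h1
        · simp [v, y, hne.symm]
        · simp [v, y, h0, h1]
  have hv₀ : v (Sum.inr i₀) = Polynomial.X := by simp [v, hne]
  have hv (i) (hi : i ≠ Sum.inr i₀) : (v i).natDegree = 0 := by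
    rcases i with i | i
    · simp [v]
    · have h0 : i ≠ i₀ := fun h => hi (by rw [h])
      rcases eq_or_ne i i₁ with rfl | h1
      · simp [v, hne.symm]
      · simp [v, h0, h1]
  have hdeg : (aeval v c).natDegree ≤ Fintype.card k := by
    refine natDegree_aeval_le_of_isHomogeneous hhom v fun i => ?_
    rcases eq_or_ne i (Sum.inr i₀) with rfl | hi
    · rw [hv₀]; exact Polynomial.natDegree_X_le
    · rw [hv i hi]; exact zero_le
  have hshift (a : k) : (aeval v c).eval (a • u) = (aeval v c).eval 0 := by
    rw [hveval, hveval, ← aeval_shear_of_mem_invariantRing hc x (y 0)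
      (B := Matrix.single i₀ i₀ a) (by simp [IsSymm])]
    congr 3
    ext i : 1
    rcases eq_or_ne i i₀ with rfl | h0
    · simp [x, y, hne, Matrix.single_apply, ite_smul, Finset.sum_add_distrib]
    · simp [y, h0, h0.symm]
  have hswap : (aeval v c).eval t = aeval (Sum.elim x 0) c := by
    rw [hveval, ← aeval_shear_of_mem_invariantRing hc x 0
      (B := Matrix.single i₀ i₁ 1 + Matrix.single i₁ i₀ 1) (by simp [IsSymm, add_comm])]
    congr 3
    ext i : 1
    rcases eq_or_ne i i₀ with rfl | h0
    · simp [x, y, hne, hne.symm, Matrix.single_apply, ite_smul, Finset.sum_add_distrib]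
    · rcases eq_or_ne i i₁ with rfl | h1
      · simp [x, y, hne, hne.symm, Matrix.single_apply, ite_smul, Finset.sum_add_distrib]
      · simp [y, h0, h0.symm, h1, h1.symm]
  have key := eval_eq_of_eval_smul_eq Polynomial.X_ne_zero hdeg hshift t
  rw [hswap, hveval, coeff_aeval_of_isHomogeneous hhom v _ hv₀ hv] at key
  have key₀ := congrArg (Polynomial.aeval (0 : Polynomial k) |>.restrictScalars k) key
  rw [map_add, map_mul, comp_aeval_apply, comp_aeval_apply] at key₀
  have hpoint : (fun i => (Polynomial.aeval (0 : Polynomial k) |>.restrictScalars k)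
      ((Sum.elim x 0 : _ → A) i)) =
      fun i => (Polynomial.aeval (0 : Polynomial k) |>.restrictScalars k)
        ((Sum.elim x (y 0) : _ → A) i) := by
    ext (i | i) : 1
    · rfl
    · rcases eq_or_ne i i₁ with rfl | h1
      · simp [y, u]
      · simp [y, h1]
  have hfactor (a : k) : (Polynomial.aeval (0 : Polynomial k) |>.restrictScalars k) (t - a • u) =
      Polynomial.X := by
    rw [map_sub, map_smul]
    simp [t, u]
  rw [hpoint, left_eq_add, map_prod, AlgHom.commutes] at key₀
  simpa [hfactor] using key₀

/-- No invariant involves the monomial `yᵢ ^ |k|`. -/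
theorem coeff_single_inr_eq_zero [Fintype k] {n : ℕ} (hn : 2 ≤ n) (i : Fin n)
    {c : MvPolynomial (Fin n ⊕ Fin n) k}
    (hc : c ∈ invariantRing (symmetricTransvections n k)) :
    coeff (Finsupp.single (Sum.inr i) (Fintype.card k)) c = 0 := by
  have : Nontrivial (Fin n) := Fin.nontrivial_iff_two_le.mpr hn
  obtain ⟨j, hj⟩ := exists_ne i
  have := coeff_single_inr_eq_zero_of_isHomogeneous hj.symm
    (homogeneousComponent_mem_invariantRing hc (Fintype.card k))
    (homogeneousComponent_isHomogeneous _ _)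
  rwa [coeff_homogeneousComponent, if_pos (Finsupp.degree_single _ _)] at this

theorem coeff_sum_X_inl_mul {n : ℕ} (c : Fin n → MvPolynomial (Fin n ⊕ Fin n) k)
    (i : Fin n) (q : ℕ) :
    coeff (Finsupp.single (Sum.inl i) 1 + Finsupp.single (Sum.inr i) q)
      (∑ j, X (Sum.inl j) * c j) = coeff (Finsupp.single (Sum.inr i) q) (c i) := by
  rw [coeff_sum, Finset.sum_eq_single i, coeff_X_mul]
  · intro j _ hj
    rw [coeff_X_mul', if_neg]
    simp [hj.symm]
  · simp

/-- No nonzero multiple of the Frobenius pairing lies in the ideal of the invariant ring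
generated by the coordinates `xᵢ`. -/
theorem eq_zero_of_smul_frobeniusPairing_eq [Fintype k] {n : ℕ} (hn : 2 ≤ n) {a : k}
    {c : Fin n → MvPolynomial (Fin n ⊕ Fin n) k}
    (hc : ∀ i, c i ∈ invariantRing (symmetricTransvections n k))
    (h : a • frobeniusPairing n k = ∑ i, X (Sum.inl i) * c i) : a = 0 := by
  let i : Fin n := ⟨0, by omega⟩
  have hcoeff := congrArg (coeff (Finsupp.single (Sum.inl i) 1 +
    Finsupp.single (Sum.inr i) (Fintype.card k))) h
  have hq : Fintype.card k - 1 ≠ 0 := by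
    have := Fintype.one_lt_card (α := k)
    omega
  rw [coeff_smul, frobeniusPairing, coeff_sum_X_inl_mul, coeff_sum_X_inl_mul,
    coeff_single_inr_eq_zero hn i (hc i), coeff_sub, coeff_X_pow, if_pos rfl,
    coeff_mul_X', coeff_X_pow] at hcoeff
  have hne : Finsupp.single (Sum.inl i : Fin n ⊕ Fin n) (Fintype.card k - 1) ≠
      Finsupp.single (Sum.inr i) (Fintype.card k) - Finsupp.single (Sum.inr i) 1 := by
    intro heq
    have := DFunLike.congr_fun heq (Sum.inl i)
    simp [hq] at this
  rw [if_neg hne, ite_self, zero_sub, smul_eq_mul, mul_neg_one, neg_eq_zero] at hcoeff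
  exact hcoeff

theorem not_directSummand_symmetricTransvections [Fintype k] {n : ℕ} (hn : 2 ≤ n) :
    ¬ DirectSummand (symmetricTransvections n k) := by
  rintro ⟨π, hsurj, hgr⟩
  have hπ1 : (π 1 : MvPolynomial (Fin n ⊕ Fin n) k) = C (coeff 0 (π 1).1) := by
    rw [← homogeneousComponent_zero, homogeneousComponent_eq_self (hgr 0 1 (isHomogeneous_one _ _))]
  set a := coeff 0 (π 1).1
  have hlin (r : invariantRing (symmetricTransvections n k)) (f) :
      (π (r.1 * f)).1 = r.1 * (π f).1 := congrArg Subtype.val (π.map_smul r f)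
  have ha : a = 0 := by
    refine eq_zero_of_smul_frobeniusPairing_eq hn (c := fun i => (π (X (Sum.inl i) ^
      (Fintype.card k - 1) * X (Sum.inr i) - X (Sum.inr i) ^ Fintype.card k)).1)
      (fun i => (π _).2) ?_
    have h1 := hlin ⟨_, frobeniusPairing_mem_invariantRing (k := k) n⟩ 1
    rw [hπ1] at h1
    rw [smul_eq_C_mul, mul_comm, ← h1, mul_one]
    simp only [frobeniusPairing, map_sum, AddSubmonoidClass.coe_finsetSum]
    exact Finset.sum_congr rfl fun i _ => hlin ⟨_, X_inl_mem_invariantRing i⟩ _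
  obtain ⟨f, hf⟩ := hsurj 1
  have hcomp : homogeneousComponent 0 (π f).1 = 0 := by
    rw [← sum_homogeneousComponent f, map_sum, AddSubmonoidClass.coe_finsetSum, map_sum]
    refine Finset.sum_eq_zero fun d _ => ?_
    rw [homogeneousComponent_of_mem (hgr d _ (homogeneousComponent_isHomogeneous d f))]
    split_ifs with hd
    · subst hd
      have h2 := hlin (algebraMap k _ (coeff 0 f)) 1
      rw [hπ1, ha, map_zero, mul_zero, mul_one] at h2
      rw [homogeneousComponent_zero]
      exact h2
    · rfl
  rw [hf, homogeneousComponent_zero] at hcomp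
  simp at hcomp

/-- The differential at the origin of a polynomial in `f` is a combination of the differentials of
the members of `f`. -/
theorem differential_mem_span_of_mem_adjoin {σ κ : Type*} {f : κ → MvPolynomial σ k}
    {p : MvPolynomial σ k} (hp : p ∈ Algebra.adjoin k (Set.range f)) :
    (fun i => constantCoeff (pderiv i p)) ∈
      Submodule.span k (Set.range fun j i => constantCoeff (pderiv i (f j))) := by
  induction hp using Algebra.adjoin_induction with
  | mem p hp =>
    obtain ⟨j, rfl⟩ := hp
    exact Submodule.subset_span ⟨j, rfl⟩
  | algebraMap r =>
    convert Submodule.zero_mem _ with i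
    simp [algebraMap_eq]
  | add p q _ _ hp hq =>
    convert Submodule.add_mem _ hp hq using 1
    ext i
    simp
  | mul p q _ _ hp hq =>
    convert Submodule.add_mem _ (Submodule.smul_mem _ (constantCoeff p) hq)
      (Submodule.smul_mem _ (constantCoeff q) hp) using 1
    ext i
    simp

/-- If the algebra generated by homogeneous polynomials contains some of the variables, then there
are at least as many linear forms among the generators. -/
theorem card_le_card_isHomogeneous_one {σ κ τ : Type*} [Finite κ] [Fintype τ]
    {f : κ → MvPolynomial σ k} (hf : ∀ i, ∃ d, (f i).IsHomogeneous d) {e : τ → σ}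
    (he : Function.Injective e) (h : ∀ t, X (e t) ∈ Algebra.adjoin k (Set.range f)) :
    Fintype.card τ ≤ Nat.card {i // (f i).IsHomogeneous 1} := by
  classical
  have := Fintype.ofFinite κ
  let D (i : κ) : σ → k := fun s => constantCoeff (pderiv s (f i))
  have hD (i : κ) (hi : ¬ (f i).IsHomogeneous 1) : D i = 0 := by
    obtain ⟨d, hd⟩ := hf i
    have hd1 : d ≠ 1 := by rintro rfl; exact hi hd
    ext s
    simp only [D, Pi.zero_apply]
    rcases Nat.eq_zero_or_pos d with rfl | hpos
    · rw [← totalDegree_zero_iff_isHomogeneous, totalDegree_eq_zero_iff_eq_C] at hd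
      rw [hd, pderiv_C, map_zero]
    · exact hd.pderiv.coeff_eq_zero (by simp; omega)
  let D' : {i // (f i).IsHomogeneous 1} → σ → k := fun i => D i
  let L : τ → σ → k := fun t => Pi.single (e t) 1
  have hL : LinearIndependent k L := (Pi.linearIndependent_single_one σ k).comp e he
  have hle : Submodule.span k (Set.range L) ≤ Submodule.span k (Set.range D') := by
    rw [Submodule.span_le]
    rintro _ ⟨t, rfl⟩
    have hmem := differential_mem_span_of_mem_adjoin (h t)
    have hLt : L t = fun i => constantCoeff (pderiv i (X (e t) : MvPolynomial σ k)) := by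
      ext s
      rcases eq_or_ne s (e t) with rfl | hs
      · simp [L]
      · simp [L, pderiv_X_of_ne hs.symm, hs]
    rw [hLt]
    refine Submodule.span_le.mpr ?_ hmem
    rintro _ ⟨i, rfl⟩
    by_cases hi : (f i).IsHomogeneous 1
    · exact Submodule.subset_span ⟨⟨i, hi⟩, rfl⟩
    · exact (congrArg (· ∈ Submodule.span k (Set.range D')) (hD i hi)).mpr (Submodule.zero_mem _)
  have : FiniteDimensional k (Submodule.span k (Set.range D')) :=
    FiniteDimensional.span_of_finite k (Set.finite_range D')
  rw [← finrank_span_eq_card hL, Nat.card_eq_fintype_card]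
  exact (Submodule.finrank_mono hle).trans (finrank_range_le_card D')

theorem exists_eq_sum_X_inl_of_isHomogeneous_one {n : ℕ} {f : MvPolynomial (Fin n ⊕ Fin n) k}
    (hf : f ∈ invariantRing (symmetricTransvections n k)) (hhom : f.IsHomogeneous 1) :
    ∃ a : Fin n → k, f = ∑ i, a i • X (Sum.inl i) := by
  rw [← mem_homogeneousSubmodule, homogeneousSubmodule_one_eq_span_X] at hhom
  obtain ⟨a, rfl⟩ := (Submodule.mem_span_range_iff_exists_fun k).mp hhom
  have ha (i : Fin n) : a (Sum.inr i) = 0 := by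
    have := aeval_shear_of_mem_invariantRing hf (A := k) (Pi.single i 1) 0
      (B := Matrix.single i i 1) (by simp [IsSymm])
    simpa [Fintype.sum_sum_type, Matrix.single_apply, Pi.single_apply, ite_and] using this
  exact ⟨fun i => a (Sum.inl i), by simp [Fintype.sum_sum_type, ha]⟩

/-- The product of the orbit of `yⱼ` is an invariant restricting to a power of `yⱼ` on `x = 0`. -/
theorem exists_mem_invariantRing_aeval_eq_pow [Fintype k] {n : ℕ} (j : Fin n) :
    ∃ N > 0, ∃ g ∈ invariantRing (symmetricTransvections n k),
      aeval (Sum.elim 0 X : _ → MvPolynomial (Fin n) k) g = X j ^ N := by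
  classical
  let s : Finset (Matrix (Fin n) (Fin n) k) := {B | B.IsSymm}
  let y (B : Matrix (Fin n) (Fin n) k) : MvPolynomial (Fin n ⊕ Fin n) k :=
    X (Sum.inr j) + ∑ l, C (B j l) * X (Sum.inl l)
  refine ⟨s.card, Finset.card_pos.mpr ⟨0, by simp [s]⟩, ∏ B ∈ s, y B, ?_, ?_⟩
  · rw [mem_invariantRing_symmetricTransvections]
    intro B' hB'
    rw [map_prod]
    refine Finset.prod_equiv (Equiv.addRight B') (fun B => ?_) fun B _ => ?_
    · simp only [s, Finset.mem_filter, Finset.mem_univ, true_and, Equiv.coe_addRight]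
      exact ⟨fun h => h.add hB', fun h => by simpa using h.sub hB'⟩
    · simp [y, polySub, Fintype.sum_sum_type, Matrix.one_apply, add_mul, Finset.sum_add_distrib]
      ring
  · simp [y]

theorem not_coregular_symmetricTransvections [Fintype k] {n : ℕ} (hn : 2 ≤ n) :
    ¬ Coregular (symmetricTransvections n k) := by
  classical
  rintro ⟨f, hhom, -, hadj⟩
  have hmem (i) : f i ∈ invariantRing (symmetricTransvections n k) :=
    hadj ▸ Algebra.subset_adjoin ⟨i, rfl⟩
  let lin (i : Fin n ⊕ Fin n) : Prop := (f i).IsHomogeneous 1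
  let ρ : MvPolynomial (Fin n ⊕ Fin n) k →ₐ[k] MvPolynomial (Fin n) k := aeval (Sum.elim 0 X)
  have hρ (i) (hi : lin i) : ρ (f i) = 0 := by
    obtain ⟨a, ha⟩ := exists_eq_sum_X_inl_of_isHomogeneous_one (hmem i) hi
    simp [ha, ρ]
  let z : {i // ¬ lin i} → MvPolynomial (Fin n) k := fun i => ρ (f i)
  have hcard : Nat.card {i // ¬ lin i} ≤ n := by
    have h1 := card_le_card_isHomogeneous_one hhom Sum.inl_injective
      (fun i => hadj ▸ X_inl_mem_invariantRing (k := k) (n := n) i)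
    have h2 := Fintype.card_subtype_compl lin
    rw [Nat.card_eq_fintype_card] at h1 ⊢
    simp only [Fintype.card_sum, Fintype.card_fin] at h1 h2
    change n ≤ Fintype.card {i // lin i} at h1
    omega
  have hrange (g) (hg : g ∈ invariantRing (symmetricTransvections n k)) :
      ρ g ∈ Algebra.adjoin k (Set.range z) := by
    rw [← hadj] at hg
    have : ρ g ∈ (Algebra.adjoin k (Set.range f)).map ρ := ⟨g, hg, rfl⟩
    rw [AlgHom.map_adjoin] at this
    refine Algebra.adjoin_le ?_ this
    rintro _ ⟨_, ⟨i, rfl⟩, rfl⟩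
    by_cases hi : lin i
    · rw [SetLike.mem_coe, hρ i hi]; exact zero_mem _
    · exact Algebra.subset_adjoin ⟨⟨i, hi⟩, rfl⟩
  have halg : Algebra.IsAlgebraic (Algebra.adjoin k (Set.range z)) (MvPolynomial (Fin n) k) := by
    have hintegral :
        Algebra.IsIntegral (Algebra.adjoin k (Set.range z)) (MvPolynomial (Fin n) k) := by
      refine ⟨fun p => ?_⟩
      induction p using MvPolynomial.induction_on with
      | C a =>
        exact isIntegral_algebraMap (x := algebraMap k (Algebra.adjoin k (Set.range z)) a)
      | add p q hp hq => exact hp.add hq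
      | mul_X p j hp =>
        obtain ⟨N, hN, g, hg, hgj⟩ := exists_mem_invariantRing_aeval_eq_pow (k := k) j
        refine hp.mul (IsIntegral.of_pow hN ?_)
        rw [← hgj]
        exact isIntegral_algebraMap (x := (⟨ρ g, hrange g hg⟩ : Algebra.adjoin k (Set.range z)))
    infer_instance
  have hz : AlgebraicIndependent k z :=
    (Algebra.IsAlgebraic.isTranscendenceBasis_of_le_trdeg_of_finite k z (by
      rw [MvPolynomial.trdeg_of_isDomain, Cardinal.mk_fin, ← Nat.cast_card]
      simpa using hcard)).1
  let J : Ideal (MvPolynomial (Fin n ⊕ Fin n) k) := Ideal.span (X '' {i | lin i})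
  let τ : MvPolynomial (Fin n ⊕ Fin n) k →ₐ[k] MvPolynomial {i // ¬ lin i} k :=
    aeval fun i => if h : lin i then 0 else X ⟨i, h⟩
  have hτ : (Ideal.Quotient.mkₐ k J).comp ((rename Subtype.val).comp τ) =
      Ideal.Quotient.mkₐ k J := by
    ext i
    by_cases hi : lin i
    · have : X i ∈ J := Ideal.subset_span ⟨i, hi, rfl⟩
      simpa [τ, hi] using (Ideal.Quotient.eq_zero_iff_mem.mpr this).symm
    · simp [τ, hi]
  have hρτ : (aeval z).comp τ = ρ.comp (aeval f) := by
    ext i : 1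
    by_cases hi : lin i
    · simp [τ, hi, hρ i hi]
    · simp [τ, hi, z]
  obtain ⟨P, hP⟩ : ∃ P, aeval f P = frobeniusPairing n k := by
    have := frobeniusPairing_mem_invariantRing (k := k) n
    rwa [← hadj, Algebra.adjoin_range_eq_range_aeval] at this
  have hτP : τ P = 0 := by
    refine (injective_iff_map_eq_zero _).mp hz _ ?_
    have := DFunLike.congr_fun hρτ P
    simp only [AlgHom.comp_apply, hP] at this
    rw [this]
    simp [frobeniusPairing, ρ]
  have hPJ : P ∈ J := by
    have := DFunLike.congr_fun hτ P
    simp only [AlgHom.comp_apply, hτP, map_zero] at this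
    exact Ideal.Quotient.eq_zero_iff_mem.mp this.symm
  let x (i : Fin n) : invariantRing (symmetricTransvections n k) :=
    ⟨X (Sum.inl i), X_inl_mem_invariantRing i⟩
  let F : MvPolynomial (Fin n ⊕ Fin n) k →ₐ[k] invariantRing (symmetricTransvections n k) :=
    aeval fun i => ⟨f i, hmem i⟩
  have hF (Q) : (F Q).1 = aeval f Q := by
    have := comp_aeval_apply (invariantRing (symmetricTransvections n k)).val
      (f := fun i => ⟨f i, hmem i⟩) Q
    simpa [F] using this
  have hJ : J ≤ (Ideal.span (Set.range x)).comap F := by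
    rw [Ideal.span_le]
    rintro _ ⟨i, hi, rfl⟩
    obtain ⟨a, ha⟩ := exists_eq_sum_X_inl_of_isHomogeneous_one (hmem i) hi
    have : F (X i) = ∑ j, algebraMap k _ (a j) * x j := by
      ext1
      rw [hF, aeval_X, ha]
      simp [x, smul_eq_C_mul, algebraMap_eq]
    rw [SetLike.mem_coe, Ideal.mem_comap, this]
    exact sum_mem fun j _ => Ideal.mul_mem_left _ _ (Ideal.subset_span ⟨j, rfl⟩)
  obtain ⟨c, hc⟩ := (Submodule.mem_span_range_iff_exists_fun _).mp (hJ hPJ)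
  refine one_ne_zero (eq_zero_of_smul_frobeniusPairing_eq hn (a := (1 : k))
    (c := fun i => (c i).1) (fun i => (c i).2) ?_)
  rw [one_smul, ← hP, ← hF]
  have := congrArg Subtype.val hc
  simp only [AddSubmonoidClass.coe_finsetSum, smul_eq_mul, MulMemClass.coe_mul, x] at this
  rw [← this]
  exact Finset.sum_congr rfl fun i _ => mul_comm _ _

/-- The action of the symplectic transvection group `G_n` on `V = k^{2n}`,
`k = F_q`, `n ≥ 2`, is not coregular and does not have the direct summand
property. -/
theorem symmetricTransvections_not_coregular_not_directSummand
    (p r n : ℕ) [Fact p.Prime] (hr : 0 < r) (q : ℕ) (hq : q = p ^ r) (hn : 2 ≤ n)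
    (k : Type) [Field k] [Fintype k] (hk : Fintype.card k = q) :
    ¬ Coregular (symmetricTransvections n k) ∧
      ¬ DirectSummand (symmetricTransvections n k) := by
  exact ⟨not_coregular_symmetricTransvections hn, not_directSummand_symmetricTransvections hn⟩
end

section
/- Let k = F_{q²}, V = k³ with coordinate functions x₁,x₂,x₃, and let H̃ ≤ GL₃(k) be the group of matrices [[1,0,0],[a,1,0],[c,-a^q,1]] with a,c ∈ k satisfying c + c^q + a^{q+1} = 0. Let η ∈ k be a primitive (q+1)-st root of unity, τ = diag(1, η^{-1}, 1), and H = ⟨H̃, τ⟩. Set F = x₁x₃^q + x₂^{q+1} + x₃x₁^q, N(x₃) = ∏_{σ∈H̃} σ·x₃, and h = x₂(x₂^{q²-1} - x₁^{q²-1}). Then the invariant ring decomposes as k[V]^{H̃} = ⊕_{i=0}^{q} k[V]^{H}·h^i as a k[V]^{H}-module, and consequently k[V]^{H̃} is generated as a k-algebra by x₁, F, N(x₃) and h. -/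
open MvPolynomial Matrix

set_option synthInstance.maxHeartbeats 1000000
set_option maxHeartbeats 1000000

variable {k : Type} [Field k] {ι : Type} [Fintype ι] [DecidableEq ι]

/-- The point stabilizer `H̃` of `⟨e₃⟩` in `SU₃(q)`: matrices
`[[1,0,0],[a,1,0],[c,-a^q,1]]` with `c + c^q + a^{q+1} = 0`. -/
def HtildeSet (q : ℕ) (k : Type) [Field k] : Set (Matrix (Fin 3) (Fin 3) k) :=
  {M | ∃ a c : k, c + c ^ q + a ^ (q + 1) = 0 ∧
    M = !![1, 0, 0; a, 1, 0; c, -(a ^ q), 1]}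

/-- The diagonal matrix `τ = diag(1, η⁻¹, 1)`. -/
def tauMat (k : Type) [Field k] (η : k) : Matrix (Fin 3) (Fin 3) k :=
  !![1, 0, 0; 0, η⁻¹, 0; 0, 0, 1]

/-- The polynomial `h = x₂ (x₂^{q²-1} - x₁^{q²-1})`. -/
noncomputable def hPoly (q : ℕ) (k : Type) [Field k] : MvPolynomial (Fin 3) k :=
  X 1 * (X 1 ^ (q ^ 2 - 1) - X 0 ^ (q ^ 2 - 1))

/-- The invariant `F = x₁x₃^q + x₂^{q+1} + x₃x₁^q`. -/
noncomputable def FPoly (q : ℕ) (k : Type) [Field k] : MvPolynomial (Fin 3) k :=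
  X 0 * X 2 ^ q + X 1 ^ (q + 1) + X 2 * X 0 ^ q

/-- The norm `N(x₃) = ∏_{σ ∈ H̃} σ·x₃`. -/
noncomputable def NPoly (q : ℕ) (k : Type) [Field k] [Fintype k] :
    MvPolynomial (Fin 3) k :=
  ∏ M ∈ (Set.toFinite (HtildeSet q k)).toFinset, polyAct M (X 2)

section General

variable {R : Type*} [CommRing R]

/-- A monic polynomial with as many distinct roots as its degree is the product of the
corresponding linear factors. -/
theorem eval_eq_prod_of_monic_of_roots [IsDomain R] {ι : Type*} (s : Finset ι) (e : ι → R)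
    (he : Set.InjOn e s) (P : Polynomial R) (hP : P.Monic) (hdeg : P.natDegree = s.card)
    (hroot : ∀ i ∈ s, P.eval (e i) = 0) (y : R) :
    P.eval y = ∏ i ∈ s, (y - e i) := by
  have hdegree : P.degree = s.card := by
    rw [Polynomial.degree_eq_natDegree hP.ne_zero, hdeg]
  have key : P = Lagrange.nodal s e := by
    refine Polynomial.eq_of_degree_le_of_eval_index_eq s he hdegree.le ?_ ?_ ?_
    · rw [hdegree, Lagrange.degree_nodal]
    · rw [hP.leadingCoeff, (Lagrange.nodal_monic (s := s) (v := e)).leadingCoeff]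
    · intro i hi
      rw [hroot i hi, Lagrange.eval_nodal_at_node hi]
  rw [key, Lagrange.eval_nodal]

/-- If `σ` fixes the coefficients `c i` and multiplies `h ≠ 0` by a primitive `n`-th root of
unity, then `1, h, …, h ^ (n - 1)` satisfy no relation with coefficients `c`. -/
theorem coeff_eq_zero_of_sum_mul_pow_eq_zero [IsDomain R] {n : ℕ} {ζ : R} (hζ : IsPrimitiveRoot ζ n)
    (σ : R →+* R) (hσζ : σ ζ = ζ) {h : R} (hh : h ≠ 0) (hσ : σ h = ζ * h)
    (c : Fin n → R) (hc : ∀ i, σ (c i) = c i) (hsum : ∑ i, c i * h ^ (i : ℕ) = 0) (i : Fin n) :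
    c i = 0 := by
  have hiter : ∀ j : ℕ, ∑ i : Fin n, c i * h ^ (i : ℕ) * (ζ ^ (i : ℕ)) ^ j = 0 := by
    intro j
    induction j with
    | zero => simpa using hsum
    | succ j ih =>
      have h1 := congrArg σ ih
      rw [map_sum, map_zero] at h1
      rw [← h1]
      refine Finset.sum_congr rfl fun i _ => ?_
      simp only [map_mul, map_pow, hc, hσ, hσζ]
      ring
  have hinj : Function.Injective fun i : Fin n => ζ ^ (i : ℕ) := fun i j hij =>
    Fin.ext (hζ.pow_inj i.2 j.2 hij)
  have h0 := Matrix.eq_zero_of_forall_pow_sum_mul_pow_eq_zero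
    hinj fun j => hiter j
  exact (mul_eq_zero.mp (congrFun h0 i)).resolve_right (pow_ne_zero _ hh)

variable {K : Type*} [Field K] [Algebra K R]

/-- If `v * x ^ n` is a combination of `1, x, …, x ^ (n - 1)` over `S`, then so is every element
of `S[x]`, up to a power of `v`. -/
theorem exists_pow_mul_mem_span_pow (S : Subalgebra K R) {n : ℕ} (hn : 0 < n) {x v : R}
    (hv : v ∈ S) (hx : v * x ^ n ∈ Submodule.span S (Set.range fun j : Fin n => x ^ (j : ℕ)))
    {f : R} (hf : f ∈ Algebra.adjoin S {x}) :
    ∃ m : ℕ, v ^ m * f ∈ Submodule.span S (Set.range fun j : Fin n => x ^ (j : ℕ)) := by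
  set M := Submodule.span S (Set.range fun j : Fin n => x ^ (j : ℕ)) with hM
  have hsmul : ∀ s ∈ S, ∀ y ∈ M, s * y ∈ M := fun s hs y hy => M.smul_mem ⟨s, hs⟩ hy
  have hstep : ∀ y ∈ M, v * (x * y) ∈ M := by
    intro y hy
    have hle : M ≤ M.comap (LinearMap.mulLeft S (v * x)) := by
      rw [hM, Submodule.span_le]
      rintro _ ⟨j, rfl⟩
      simp only [Submodule.comap_coe, Set.mem_preimage, LinearMap.mulLeft_apply, SetLike.mem_coe]
      rw [mul_assoc, ← pow_succ']
      rcases Nat.lt_or_ge (j + 1) n with hj | hj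
      · exact hsmul v hv _ (Submodule.subset_span ⟨⟨j + 1, hj⟩, rfl⟩)
      · rwa [show (j : ℕ) + 1 = n by omega]
    simpa [mul_assoc] using hle hy
  have hone : (1 : R) ∈ M := Submodule.subset_span ⟨⟨0, hn⟩, by simp⟩
  have hpow : ∀ i : ℕ, v ^ i * x ^ i ∈ M := by
    intro i
    induction i with
    | zero => simpa using hone
    | succ i ih =>
      have := hstep _ ih
      rwa [show v * (x * (v ^ i * x ^ i)) = v ^ (i + 1) * x ^ (i + 1) by ring] at this
  rw [Algebra.adjoin_singleton_eq_range_aeval] at hf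
  obtain ⟨G, rfl⟩ := hf
  induction G using Polynomial.induction_on' with
  | add G₁ G₂ h₁ h₂ =>
    obtain ⟨m₁, h₁⟩ := h₁
    obtain ⟨m₂, h₂⟩ := h₂
    refine ⟨m₁ + m₂, ?_⟩
    have := M.add_mem (hsmul _ (pow_mem hv m₂) _ h₁) (hsmul _ (pow_mem hv m₁) _ h₂)
    convert this using 1
    simp only [map_add, AlgHom.toRingHom_eq_coe, RingHom.coe_coe]
    ring
  | monomial i s =>
    refine ⟨i, ?_⟩
    have := hsmul _ s.2 _ (hpow i)
    convert this using 1
    simp only [AlgHom.toRingHom_eq_coe, RingHom.coe_coe, Polynomial.aeval_monomial]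
    change v ^ i * ((s : R) * x ^ i) = _
    ring

/-- Let `x` satisfy an equation of degree `n` over `S` with leading coefficient `v`. An element of
`S[x]` fixed by `n` endomorphisms of `R` which fix `S` and separate `x` lies in `S`, up to a power
of `v`. -/
theorem exists_pow_mul_mem_of_forall_fixed [IsDomain R] (S : Subalgebra K R) {n : ℕ} (hn : 0 < n)
    {x v : R} (hv : v ∈ S) (hx : v * x ^ n ∈ Submodule.span S (Set.range fun j : Fin n => x ^ (j : ℕ)))
    {f : R} (hf : f ∈ Algebra.adjoin S {x}) {I : Type*} [Fintype I] (hI : Fintype.card I = n)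
    (σ : I → R →ₐ[K] R) (hσS : ∀ i, ∀ s ∈ S, σ i s = s) (hσf : ∀ i, σ i f = f)
    (hσx : Function.Injective fun i => σ i x) :
    ∃ m : ℕ, v ^ m * f ∈ S := by
  obtain ⟨m, hm⟩ := exists_pow_mul_mem_span_pow S hn hv hx hf
  refine ⟨m, ?_⟩
  obtain ⟨c, hc⟩ := (Submodule.mem_span_range_iff_exists_fun _).mp hm
  have hc' : ∑ j : Fin n, (c j : R) * x ^ (j : ℕ) = v ^ m * f := hc
  set P : Polynomial R :=
    ∑ j : Fin n, Polynomial.C (c j : R) * Polynomial.X ^ (j : ℕ) - Polynomial.C (v ^ m * f) with hP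
  have hP0 : P = 0 := by
    refine Polynomial.eq_zero_of_natDegree_lt_card_of_eval_eq_zero P hσx (fun i => ?_) ?_
    · have h1 := congrArg (σ i) hc'
      simp only [map_sum, map_mul, map_pow, hσS i _ (c _).2, hσS i v hv, hσf i] at h1
      simp only [hP, Polynomial.eval_sub, Polynomial.eval_finsetSum, Polynomial.eval_mul,
        Polynomial.eval_C, Polynomial.eval_pow, Polynomial.eval_X]
      rw [h1, sub_self]
    · rw [hI]
      have hle : P.natDegree ≤ n - 1 := by
        have hterm : ∀ j ∈ Finset.univ, (Polynomial.C (c j : R) *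
            Polynomial.X ^ (j : ℕ)).natDegree ≤ n - 1 := fun j _ =>
          (Polynomial.natDegree_C_mul_X_pow_le _ _).trans (Nat.le_sub_one_of_lt j.2)
        refine (Polynomial.natDegree_sub_le_of_le (n := n - 1)
          (Polynomial.natDegree_sum_le_of_forall_le _ _ hterm) ?_).trans (max_self _).le
        rw [Polynomial.natDegree_C]
        exact Nat.zero_le _
      omega
  have h0 := congrArg (fun Q => Polynomial.coeff Q 0) hP0
  simp only [hP, Polynomial.coeff_sub, Polynomial.finsetSum_coeff, Polynomial.coeff_C_mul,
    Polynomial.coeff_X_pow, Polynomial.coeff_C_zero, Polynomial.coeff_zero, sub_eq_zero] at h0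
  rw [← h0]
  refine S.sum_mem fun j _ => S.mul_mem (c j).2 ?_
  split_ifs
  exacts [S.one_mem, S.zero_mem]

end General

section Action

theorem mem_invariantRing {S : Set (Matrix ι ι k)} {f : MvPolynomial ι k} :
    f ∈ invariantRing S ↔ ∀ g ∈ S, polyAct g f = f := by
  simp [invariantRing, Algebra.mem_iInf, AlgHom.mem_equalizer]

theorem polyAct_X_of_mul_eq_one {g g' : Matrix ι ι k} (h : g * g' = 1) (i : ι) :
    polyAct g (X i) = ∑ j, C (g' i j) * X j := by
  rw [polyAct, polySub, aeval_X, Matrix.inv_eq_right_inv h]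

variable {q : ℕ} {a c : k}

/-- The element of `H̃` with parameters `a` and `c`. -/
def htildeMat (q : ℕ) (a c : k) : Matrix (Fin 3) (Fin 3) k :=
  !![1, 0, 0; a, 1, 0; c, -(a ^ q), 1]

theorem htildeMat_mul_inverse (h : c + c ^ q + a ^ (q + 1) = 0) :
    htildeMat q a c * !![1, 0, 0; -a, 1, 0; c ^ q, a ^ q, 1] = 1 := by
  have h' : c + a ^ q * a + c ^ q = 0 := by rw [← h]; ring
  ext i j
  fin_cases i <;> fin_cases j <;>
    simp [htildeMat, Matrix.mul_apply, Fin.sum_univ_three, h']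

theorem polyAct_htildeMat_X_zero (h : c + c ^ q + a ^ (q + 1) = 0) :
    polyAct (htildeMat q a c) (X 0) = X 0 := by
  simp [polyAct_X_of_mul_eq_one (htildeMat_mul_inverse h), Fin.sum_univ_three]

theorem polyAct_htildeMat_X_one (h : c + c ^ q + a ^ (q + 1) = 0) :
    polyAct (htildeMat q a c) (X 1) = X 1 - C a * X 0 := by
  simp [polyAct_X_of_mul_eq_one (htildeMat_mul_inverse h), Fin.sum_univ_three]
  ring

theorem polyAct_htildeMat_X_two (h : c + c ^ q + a ^ (q + 1) = 0) :
    polyAct (htildeMat q a c) (X 2) = X 2 + C (a ^ q) * X 1 + C (c ^ q) * X 0 := by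
  simp [polyAct_X_of_mul_eq_one (htildeMat_mul_inverse h), Fin.sum_univ_three]
  ring

variable {η : k}

theorem tauMat_mul_inverse (hη : η ≠ 0) :
    tauMat k η * !![1, 0, 0; 0, η, 0; 0, 0, 1] = 1 := by
  ext i j
  fin_cases i <;> fin_cases j <;>
    simp [tauMat, Matrix.mul_apply, Fin.sum_univ_three, hη]

theorem polyAct_tauMat_X_zero (hη : η ≠ 0) : polyAct (tauMat k η) (X 0) = X 0 := by
  simp [polyAct_X_of_mul_eq_one (tauMat_mul_inverse hη), Fin.sum_univ_three]

theorem polyAct_tauMat_X_one (hη : η ≠ 0) : polyAct (tauMat k η) (X 1) = C η * X 1 := by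
  simp [polyAct_X_of_mul_eq_one (tauMat_mul_inverse hη), Fin.sum_univ_three]

theorem polyAct_tauMat_X_two (hη : η ≠ 0) : polyAct (tauMat k η) (X 2) = X 2 := by
  simp [polyAct_X_of_mul_eq_one (tauMat_mul_inverse hη), Fin.sum_univ_three]

theorem polyAct_tauMat_FPoly (hη : η ≠ 0) (hq : η ^ (q + 1) = 1) :
    polyAct (tauMat k η) (FPoly q k) = FPoly q k := by
  simp only [FPoly, map_add, map_mul, map_pow, polyAct_tauMat_X_zero hη,
    polyAct_tauMat_X_one hη, polyAct_tauMat_X_two hη, mul_pow, ← C_pow, hq, C_1, one_mul]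

theorem hPoly_eq (hq : 0 < q) :
    hPoly q k = X 1 ^ q ^ 2 - X 1 * X 0 ^ (q ^ 2 - 1) := by
  have h1 : q ^ 2 = q ^ 2 - 1 + 1 := by have := pow_pos hq 2; omega
  rw [hPoly, mul_sub, ← pow_succ', ← h1]

theorem hPoly_ne_zero (hq : 2 ≤ q) : hPoly q k ≠ 0 := by
  intro h
  have h1 := congrArg (eval ![(0 : k), 1, 0]) h
  have h2 : q ^ 2 - 1 ≠ 0 := by
    have := Nat.pow_le_pow_left hq 2
    omega
  simp [hPoly, h2] at h1

theorem polyAct_tauMat_hPoly (hη : η ≠ 0) (hq : η ^ (q ^ 2 - 1) = 1) :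
    polyAct (tauMat k η) (hPoly q k) = C η * hPoly q k := by
  simp only [hPoly, map_sub, map_mul, map_pow, polyAct_tauMat_X_zero hη,
    polyAct_tauMat_X_one hη, mul_pow, ← C_pow, hq, C_1, one_mul]
  ring

theorem polyAct_htildeMat_FPoly {p r : ℕ} [Fact p.Prime] [CharP k p] (hq : q = p ^ r)
    (h : c + c ^ q + a ^ (q + 1) = 0) (ha : a ^ q ^ 2 = a) (hc : c ^ q ^ 2 = c) :
    polyAct (htildeMat q a c) (FPoly q k) = FPoly q k := by
  have hadd : ∀ x y : MvPolynomial (Fin 3) k, (x + y) ^ q = x ^ q + y ^ q := fun x y => by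
    rw [hq, add_pow_char_pow]
  have hsub : ∀ x y : MvPolynomial (Fin 3) k, (x - y) ^ q = x ^ q - y ^ q := fun x y => by
    rw [hq, sub_pow_char_pow]
  have h' : (C c + C c ^ q + C a ^ q * C a : MvPolynomial (Fin 3) k) = 0 := by
    rw [← pow_succ]
    simpa using congrArg (C : k → MvPolynomial (Fin 3) k) h
  have ha' : ((C a ^ q) ^ q : MvPolynomial (Fin 3) k) = C a := by
    rw [← pow_mul, ← sq, ← C_pow, ha]
  have hc' : ((C c ^ q) ^ q : MvPolynomial (Fin 3) k) = C c := by
    rw [← pow_mul, ← sq, ← C_pow, hc]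
  simp only [FPoly, map_add, map_mul, map_pow, polyAct_htildeMat_X_zero h,
    polyAct_htildeMat_X_one h, polyAct_htildeMat_X_two h, pow_succ, hadd, hsub, mul_pow, ha', hc']
  linear_combination X 0 ^ q * X 0 * h'

theorem polyAct_htildeMat_hPoly {p r : ℕ} [Fact p.Prime] [CharP k p] (hq : q = p ^ r)
    (h : c + c ^ q + a ^ (q + 1) = 0) (ha : a ^ q ^ 2 = a) :
    polyAct (htildeMat q a c) (hPoly q k) = hPoly q k := by
  have hq0 : 0 < q := hq ▸ pow_pos (Fact.out : p.Prime).pos r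
  have hsub : ∀ x y : MvPolynomial (Fin 3) k, (x - y) ^ q ^ 2 = x ^ q ^ 2 - y ^ q ^ 2 :=
    fun x y => by rw [hq, ← pow_mul, sub_pow_char_pow]
  have h1 : (X 0 : MvPolynomial (Fin 3) k) ^ q ^ 2 = X 0 ^ (q ^ 2 - 1) * X 0 := by
    rw [← pow_succ]
    congr 1
    have := pow_pos hq0 2
    omega
  simp only [hPoly_eq hq0, map_sub, map_mul, map_pow, polyAct_htildeMat_X_zero h,
    polyAct_htildeMat_X_one h, hsub, mul_pow, ← C_pow, ha]
  rw [h1]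
  ring

end Action

section Norm

open Classical in
/-- The parameters `c` of the elements of `H̃` with given parameter `a`. -/
noncomputable def htildeFiber [Fintype k] (q : ℕ) (a : k) : Finset k :=
  Finset.univ.filter fun c => c + c ^ q + a ^ (q + 1) = 0

theorem mem_htildeFiber [Fintype k] {q : ℕ} {a c : k} :
    c ∈ htildeFiber q a ↔ c + c ^ q + a ^ (q + 1) = 0 := by
  simp [htildeFiber]

theorem card_le_of_forall_eval_eq_zero {P : Polynomial k} {n : ℕ} (hP : P.Monic)
    (hdeg : P.natDegree = n) (s : Finset k) (hs : ∀ x ∈ s, P.eval x = 0) : s.card ≤ n := by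
  rw [← hdeg]
  refine Polynomial.card_le_degree_of_subset_roots fun x hx => ?_
  exact (Polynomial.mem_roots hP.ne_zero).mpr (hs x hx)

theorem monic_X_pow_add_linear {R : Type*} [CommRing R] [Nontrivial R] {q : ℕ} (hq : 2 ≤ q)
    (b c : R) :
    (Polynomial.X ^ q + (Polynomial.C b * Polynomial.X + Polynomial.C c)).Monic ∧
      (Polynomial.X ^ q + (Polynomial.C b * Polynomial.X + Polynomial.C c)).natDegree = q := by
  have hlt : (Polynomial.C b * Polynomial.X + Polynomial.C c).degree < (q : WithBot ℕ) :=
    Polynomial.degree_linear_le.trans_lt (by exact_mod_cast hq)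
  exact ⟨Polynomial.monic_X_pow_add hlt, by
    rw [Polynomial.natDegree_add_eq_left_of_degree_lt (by simpa using hlt),
      Polynomial.natDegree_X_pow]⟩

variable {p r q : ℕ} [Fact p.Prime] [CharP k p] [Fintype k]

theorem card_htildeFiber (hq : q = p ^ r) (hq2 : 2 ≤ q) (hk : Fintype.card k = q ^ 2) (a : k) :
    (htildeFiber q a).card = q := by
  classical
  have hpow : ∀ x : k, (x ^ q) ^ q = x := fun x => by
    rw [← pow_mul, ← sq, ← hk, FiniteField.pow_card]
  have hadd : ∀ x y : k, (x + y) ^ q = x ^ q + y ^ q := fun x y => by rw [hq, add_pow_char_pow]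
  have hneg : ∀ x : k, (-x) ^ q = -x ^ q := fun x => by
    have := hadd (-x) x
    rw [neg_add_cancel, zero_pow (by omega)] at this
    linear_combination -this
  set T : Finset k := Finset.univ.filter fun t => t ^ q = t with hT
  have hTcard : T.card ≤ q := by
    obtain ⟨hm, hd⟩ := monic_X_pow_add_linear (R := k) hq2 (-1) 0
    refine card_le_of_forall_eval_eq_zero hm hd T fun x hx => ?_
    have hx' : x ^ q = x := by simpa [hT] using hx
    simp [hx']
  have hfib : ∀ t : k, (Finset.univ.filter fun c : k => c + c ^ q = t).card ≤ q := by
    intro t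
    obtain ⟨hm, hd⟩ := monic_X_pow_add_linear (R := k) hq2 1 (-t)
    refine card_le_of_forall_eval_eq_zero hm hd _ fun x hx => ?_
    have hx' : x + x ^ q = t := by simpa using hx
    simp [← hx']
  have hmaps : ∀ c ∈ (Finset.univ : Finset k), c + c ^ q ∈ T := by
    intro c _
    simp only [hT, Finset.mem_filter, Finset.mem_univ, true_and]
    rw [hadd, hpow, add_comm]
  have hsum := Finset.card_eq_sum_card_fiberwise (f := fun c : k => c + c ^ q) hmaps
  rw [Finset.card_univ, hk] at hsum
  have hmem : -a ^ (q + 1) ∈ T := by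
    simp only [hT, Finset.mem_filter, Finset.mem_univ, true_and]
    rw [hneg, pow_succ, mul_pow, hpow, mul_comm]
  have heq : htildeFiber q a = Finset.univ.filter fun c : k => c + c ^ q = -a ^ (q + 1) := by
    ext c
    rw [mem_htildeFiber, Finset.mem_filter, eq_neg_iff_add_eq_zero]
    simp
  rw [heq]
  by_contra hne
  have hlt := Finset.sum_lt_sum (s := T) (g := fun _ => q) (fun t _ => hfib t)
    ⟨_, hmem, lt_of_le_of_ne (hfib _) hne⟩
  rw [← hsum, Finset.sum_const, smul_eq_mul] at hlt
  nlinarith [Nat.mul_le_mul_right q hTcard]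

theorem NPoly_eq_prod (q : ℕ) :
    NPoly q k = ∏ a : k, ∏ c ∈ htildeFiber q a, (X 2 + C (a ^ q) * X 1 + C (c ^ q) * X 0) := by
  rw [NPoly, Finset.prod_sigma']
  symm
  refine Finset.prod_bij (fun x _ => htildeMat q x.1 x.2) ?_ ?_ ?_ ?_
  · rintro ⟨a, c⟩ hx
    rw [Finset.mem_sigma, mem_htildeFiber] at hx
    exact (Set.Finite.mem_toFinset _).mpr ⟨a, c, hx.2, rfl⟩
  · rintro ⟨a, c⟩ _ ⟨a', c'⟩ _ h
    have h1 : a = a' := by simpa [htildeMat] using congrFun (congrFun h 1) 0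
    have h2 : c = c' := by simpa [htildeMat] using congrFun (congrFun h 2) 0
    rw [h1, h2]
  · intro M hM
    obtain ⟨a, c, h, rfl⟩ := (Set.Finite.mem_toFinset _).mp hM
    exact ⟨⟨a, c⟩, by simpa [mem_htildeFiber] using h, rfl⟩
  · rintro ⟨a, c⟩ hx
    rw [Finset.mem_sigma, mem_htildeFiber] at hx
    exact (polyAct_htildeMat_X_two hx.2).symm

theorem X_zero_mul_prod_htildeFiber (hq : q = p ^ r) (hq2 : 2 ≤ q)
    (hk : Fintype.card k = q ^ 2) (a : k) :
    X 0 * ∏ c ∈ htildeFiber q a, (X 2 + C (a ^ q) * X 1 + C (c ^ q) * X 0) =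
      FPoly q k - (X 1 - C a * X 0) ^ (q + 1) := by
  set R := MvPolynomial (Fin 3) k
  have hpow : ∀ x : k, x ^ q ^ 2 = x := fun x => by rw [← hk, FiniteField.pow_card]
  have hadd : ∀ x y : R, (x + y) ^ q = x ^ q + y ^ q := fun x y => by
    rw [hq, add_pow_char_pow]
  have hsub : ∀ x y : R, (x - y) ^ q = x ^ q - y ^ q := fun x y => by
    rw [hq, sub_pow_char_pow]
  have ha : ((C a ^ q) ^ q : R) = C a := by
    rw [← pow_mul, ← sq, ← C_pow, hpow]
  have hX : (X 0 : R) ^ q = X 0 ^ (q - 1) * X 0 := by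
    rw [← pow_succ]
    congr 1
    omega
  obtain ⟨hm, hd⟩ := monic_X_pow_add_linear (R := R) hq2 (X 0 ^ (q - 1))
    (C (a ^ (q + 1)) * X 0 ^ q)
  have hprod := eval_eq_prod_of_monic_of_roots (htildeFiber q a) (fun c => C c * X 0) ?_ _ hm
    (hd.trans (card_htildeFiber hq hq2 hk a).symm) ?_
    (X 2 + C (a ^ q) * X 1 - C (a ^ (q + 1)) * X 0)
  · have hfac : ∀ c ∈ htildeFiber q a, (X 2 + C (a ^ q) * X 1 + C (c ^ q) * X 0 : R) =
        X 2 + C (a ^ q) * X 1 - C (a ^ (q + 1)) * X 0 - C c * X 0 := by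
      intro c hc
      rw [mem_htildeFiber] at hc
      have hc' : c ^ q = -a ^ (q + 1) - c := by linear_combination hc
      rw [hc', C_sub, C_neg]
      ring
    rw [Finset.prod_congr rfl hfac, ← hprod]
    simp only [Polynomial.eval_add, Polynomial.eval_mul, Polynomial.eval_pow, Polynomial.eval_X,
      Polynomial.eval_C, FPoly, pow_succ, hadd, hsub, mul_pow, map_mul, map_pow, ha, hX]
    ring
  · intro c _ c' _ h
    exact C_injective _ _ (mul_right_cancel₀ (X_ne_zero 0) h)
  · intro c hc
    rw [mem_htildeFiber] at hc
    have hc' : (C c + C c ^ q + C (a ^ (q + 1)) : R) = 0 := by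
      simpa using congrArg (C : k → R) hc
    simp only [Polynomial.eval_add, Polynomial.eval_mul, Polynomial.eval_pow, Polynomial.eval_X,
      Polynomial.eval_C, mul_pow, hX]
    linear_combination hc' * (X 0 ^ (q - 1) * X 0)

/-- The relation between `x₁`, `F`, `N(x₃)` and `h`. -/
theorem X_zero_pow_mul_NPoly (hq : q = p ^ r) (hq2 : 2 ≤ q) (hk : Fintype.card k = q ^ 2) :
    X 0 ^ q ^ 2 * NPoly q k =
      FPoly q k * (FPoly q k ^ (q - 1) - X 0 ^ (q ^ 2 - 1)) ^ (q + 1) - hPoly q k ^ (q + 1) := by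
  set R := MvPolynomial (Fin 3) k
  have hpow : ∀ x : k, x ^ q ^ 2 = x := fun x => by rw [← hk, FiniteField.pow_card]
  have hq1 : (q - 1) * (q + 1) = q ^ 2 - 1 := by
    rw [mul_comm, ← Nat.sq_sub_sq q 1, one_pow]
  have hleft : X 0 ^ q ^ 2 * NPoly q k =
      ∏ a : k, (FPoly q k - (X 1 - C a * X 0) ^ (q + 1)) := by
    rw [NPoly_eq_prod, ← hk, ← Finset.card_univ, ← Finset.prod_const, ← Finset.prod_mul_distrib]
    exact Finset.prod_congr rfl fun a _ => X_zero_mul_prod_htildeFiber hq hq2 hk a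
  have hmonic₀ : (Polynomial.X ^ (q - 1) -
      Polynomial.C (X 0 ^ (q ^ 2 - 1) : R)).Monic :=
    Polynomial.monic_X_pow_sub_C _ (by omega)
  have hmonic₁ := Polynomial.monic_X.mul (hmonic₀.pow (q + 1))
  have hdeg₁ : (Polynomial.X * (Polynomial.X ^ (q - 1) -
      Polynomial.C (X 0 ^ (q ^ 2 - 1) : R)) ^ (q + 1)).natDegree = q ^ 2 := by
    rw [Polynomial.monic_X.natDegree_mul (hmonic₀.pow _), hmonic₀.natDegree_pow,
      Polynomial.natDegree_X_pow_sub_C, Polynomial.natDegree_X, mul_comm, hq1]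
    have := Nat.pow_le_pow_left hq2 2
    omega
  have hlt : (Polynomial.C (hPoly q k ^ (q + 1))).degree <
      (Polynomial.X * (Polynomial.X ^ (q - 1) -
        Polynomial.C (X 0 ^ (q ^ 2 - 1) : R)) ^ (q + 1)).degree := by
    refine Polynomial.degree_C_le.trans_lt ?_
    rw [Polynomial.degree_eq_natDegree hmonic₁.ne_zero, hdeg₁]
    exact_mod_cast pow_pos (by omega : 0 < q) 2
  have hprod := eval_eq_prod_of_monic_of_roots Finset.univ
    (fun a : k => (X 1 - C a * X 0 : R) ^ (q + 1)) ?_ _ (hmonic₁.sub_of_left hlt) ?_ ?_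
    (FPoly q k)
  · rw [hleft, ← hprod]
    simp
  · intro a _ b _ h
    have h1 : (b - a) ^ (q + 1) = 0 := by
      simpa using congrArg (eval ![(1 : k), b, 0]) h
    exact (sub_eq_zero.mp (pow_eq_zero_iff (Nat.succ_ne_zero q) |>.mp h1)).symm
  · rw [Polynomial.natDegree_sub_eq_left_of_natDegree_lt, hdeg₁, Finset.card_univ, hk]
    rw [hdeg₁, Polynomial.natDegree_C]
    exact pow_pos (by omega) 2
  · intro a _
    obtain ⟨c, hc⟩ : (htildeFiber q a).Nonempty := by
      rw [← Finset.card_pos, card_htildeFiber hq hq2 hk a]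
      omega
    have hh := polyAct_htildeMat_hPoly hq (mem_htildeFiber.mp hc) (hpow a)
    rw [hPoly] at hh
    simp only [map_sub, map_mul, map_pow, polyAct_htildeMat_X_zero (mem_htildeFiber.mp hc),
      polyAct_htildeMat_X_one (mem_htildeFiber.mp hc)] at hh
    simp only [Polynomial.eval_sub, Polynomial.eval_mul, Polynomial.eval_pow, Polynomial.eval_X,
      Polynomial.eval_C]
    rw [← pow_mul, mul_comm (q + 1), hq1, ← mul_pow, hh, hPoly, sub_self]

end Norm

section Reduction

/-- Reduction modulo `x₁`, with values in `k[x₂][x₃]`. -/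
noncomputable def reduceXZero (k : Type) [Field k] :
    MvPolynomial (Fin 3) k →ₐ[k] Polynomial (Polynomial k) :=
  aeval ![0, Polynomial.C Polynomial.X, Polynomial.X]

theorem reduceXZero_C (a : k) : reduceXZero k (C a) = Polynomial.C (Polynomial.C a) := by
  rw [← MvPolynomial.algebraMap_eq, AlgHom.commutes]
  rfl

theorem X_zero_dvd_of_reduceXZero_eq_zero {f : MvPolynomial (Fin 3) k}
    (hf : reduceXZero k f = 0) : X 0 ∣ f := by
  let ψ : Polynomial (Polynomial k) →+* MvPolynomial (Fin 3) k :=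
    Polynomial.eval₂RingHom (Polynomial.aeval (X 1 : MvPolynomial (Fin 3) k)).toRingHom (X 2)
  let π := Ideal.Quotient.mkₐ k (Ideal.span {(X 0 : MvPolynomial (Fin 3) k)})
  have hψ : ∀ g : MvPolynomial (Fin 3) k, π (ψ (reduceXZero k g)) = π g := by
    intro g
    induction g using MvPolynomial.induction_on with
    | C a => simp [ψ, MvPolynomial.algebraMap_eq]
    | add f g hf hg => simp only [map_add, hf, hg]
    | mul_X f i hf =>
      rw [map_mul, map_mul, map_mul, hf, map_mul]
      congr 1
      fin_cases i
      · have : π (X 0) = 0 := Ideal.Quotient.eq_zero_iff_mem.mpr (Ideal.mem_span_singleton_self _)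
        simp [reduceXZero, this]
      · simp [reduceXZero, ψ]
      · simp [reduceXZero, ψ]
  have h0 := hψ f
  rw [hf, map_zero, map_zero] at h0
  exact Ideal.mem_span_singleton.mp (Ideal.Quotient.eq_zero_iff_mem.mp h0.symm)

theorem reduceXZero_FPoly {q : ℕ} (hq : 0 < q) :
    reduceXZero k (FPoly q k) = Polynomial.C (Polynomial.X ^ (q + 1)) := by
  simp [reduceXZero, FPoly, hq.ne']

theorem reduceXZero_hPoly_ne_zero {q : ℕ} (hq : 2 ≤ q) : reduceXZero k (hPoly q k) ≠ 0 := by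
  have h2 : q ^ 2 - 1 ≠ 0 := by
    have := Nat.pow_le_pow_left hq 2
    omega
  simp [reduceXZero, hPoly, h2]

theorem natDegree_reduceXZero_NPoly_ne_zero [Fintype k] {q : ℕ} (hq : 0 < q) :
    (reduceXZero k (NPoly q k)).natDegree ≠ 0 := by
  have hfac : ∀ a c : k, reduceXZero k (X 2 + C (a ^ q) * X 1 + C (c ^ q) * X 0) =
      Polynomial.X + Polynomial.C (Polynomial.C (a ^ q) * Polynomial.X) := by
    intro a c
    rw [map_add, map_add, map_mul, map_mul, reduceXZero_C, reduceXZero_C]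
    simp [reduceXZero]
  rw [NPoly_eq_prod, map_prod, Finset.prod_congr rfl fun a _ => by
    rw [map_prod, Finset.prod_congr rfl fun c _ => hfac a c, Finset.prod_const]]
  rw [Polynomial.natDegree_prod_of_monic _ _ fun a _ => (Polynomial.monic_X_add_C _).pow _]
  simp only [(Polynomial.monic_X_add_C _).natDegree_pow, Polynomial.natDegree_X_add_C, mul_one]
  have hmem : (0 : k) ∈ htildeFiber q (0 : k) := by
    rw [mem_htildeFiber]
    simp [hq.ne']
  have hle := Finset.single_le_sum (f := fun a : k => (htildeFiber q a).card)
    (fun _ _ => Nat.zero_le _) (Finset.mem_univ (0 : k))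
  have := Finset.card_pos.mpr ⟨_, hmem⟩
  omega

/-- The substitution `x₂ ↦ η x₂` in `k[x₂][x₃]`. -/
noncomputable def scaleInner (η : k) : Polynomial (Polynomial k) →+* Polynomial (Polynomial k) :=
  Polynomial.mapRingHom (Polynomial.aeval (Polynomial.C η * Polynomial.X)).toRingHom

theorem scaleInner_reduceXZero {η : k} (hη : η ≠ 0) (f : MvPolynomial (Fin 3) k) :
    scaleInner η (reduceXZero k f) = reduceXZero k (polyAct (tauMat k η) f) := by
  have key : (scaleInner η).comp (reduceXZero k).toRingHom =
      ((reduceXZero k).comp (polyAct (tauMat k η))).toRingHom := by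
    refine MvPolynomial.ringHom_ext (fun a => ?_) fun i => ?_
    · simp [scaleInner]
    · fin_cases i
      · simp [polyAct_tauMat_X_zero hη, reduceXZero]
      · simp [polyAct_tauMat_X_one hη]
        simp [reduceXZero, scaleInner]
      · simp [polyAct_tauMat_X_two hη, reduceXZero, scaleInner]
  exact DFunLike.congr_fun key f

/-- Evaluation of polynomials at `x₁`, `F` and `N(x₃)`. -/
noncomputable def evalGenerators (q : ℕ) (k : Type) [Field k] [Fintype k] :
    MvPolynomial (Fin 3) k →ₐ[k] MvPolynomial (Fin 3) k :=
  aeval ![X 0, FPoly q k, NPoly q k]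

variable [Fintype k] {q : ℕ}

theorem reduceXZero_evalGenerators (hq : 0 < q) (P : MvPolynomial (Fin 3) k) :
    reduceXZero k (evalGenerators q k P) =
      ((reduceXZero k P).map (Polynomial.expand k (q + 1)).toRingHom).comp
        (reduceXZero k (NPoly q k)) := by
  let κ : Polynomial (Polynomial k) →+* Polynomial (Polynomial k) :=
    (Polynomial.compRingHom (reduceXZero k (NPoly q k))).comp
      (Polynomial.mapRingHom (Polynomial.expand k (q + 1)).toRingHom)
  have key : ((reduceXZero k).comp (evalGenerators q k)).toRingHom =
      κ.comp (reduceXZero k).toRingHom := by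
    refine MvPolynomial.ringHom_ext (fun a => ?_) fun i => ?_
    · simp [κ]
    · fin_cases i
      · simp [evalGenerators, reduceXZero, κ]
      · have := reduceXZero_FPoly (k := k) hq
        simp [evalGenerators, this, κ]
        simp [reduceXZero]
      · simp [evalGenerators, κ]
        simp [reduceXZero]
  exact DFunLike.congr_fun key P

theorem X_zero_dvd_of_reduceXZero_evalGenerators_eq_zero (hq : 0 < q)
    {P : MvPolynomial (Fin 3) k} (hP : reduceXZero k (evalGenerators q k P) = 0) : X 0 ∣ P := by
  rw [reduceXZero_evalGenerators hq, Polynomial.comp_eq_zero_iff] at hP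
  have hN := natDegree_reduceXZero_NPoly_ne_zero (k := k) hq
  rcases hP with hP | ⟨-, hP⟩
  · refine X_zero_dvd_of_reduceXZero_eq_zero ?_
    exact (Polynomial.map_eq_zero_iff (Polynomial.expand_injective (Nat.succ_pos q))).mp hP
  · rw [hP, Polynomial.natDegree_C] at hN
    exact absurd rfl hN

end Reduction

section Invariants

theorem mem_invariantRing_HtildeSet {q : ℕ} {f : MvPolynomial (Fin 3) k} :
    f ∈ invariantRing (HtildeSet q k) ↔
      ∀ a c : k, c + c ^ q + a ^ (q + 1) = 0 → polyAct (htildeMat q a c) f = f := by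
  rw [mem_invariantRing]
  exact ⟨fun h a c hac => h _ ⟨a, c, hac, rfl⟩, by rintro h _ ⟨a, c, hac, rfl⟩; exact h a c hac⟩

theorem X_zero_mem_invariantRing {q : ℕ} : X 0 ∈ invariantRing (HtildeSet q k) :=
  mem_invariantRing_HtildeSet.mpr fun _ _ => polyAct_htildeMat_X_zero

variable [Fintype k] {p r q : ℕ} [Fact p.Prime] [CharP k p]

theorem FPoly_mem_invariantRing (hq : q = p ^ r) (hk : Fintype.card k = q ^ 2) :
    FPoly q k ∈ invariantRing (HtildeSet q k) :=
  mem_invariantRing_HtildeSet.mpr fun a c h => polyAct_htildeMat_FPoly hq h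
    (by rw [← hk, FiniteField.pow_card]) (by rw [← hk, FiniteField.pow_card])

theorem hPoly_mem_invariantRing (hq : q = p ^ r) (hk : Fintype.card k = q ^ 2) :
    hPoly q k ∈ invariantRing (HtildeSet q k) :=
  mem_invariantRing_HtildeSet.mpr fun a c h => polyAct_htildeMat_hPoly hq h
    (by rw [← hk, FiniteField.pow_card])

/-- An endomorphism fixing `x₁`, `F` and `h ^ (q + 1)` fixes `N(x₃)`. -/
theorem map_NPoly_eq_self (hq : q = p ^ r) (hq2 : 2 ≤ q) (hk : Fintype.card k = q ^ 2)
    (σ : MvPolynomial (Fin 3) k →ₐ[k] MvPolynomial (Fin 3) k) (h0 : σ (X 0) = X 0)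
    (hF : σ (FPoly q k) = FPoly q k) (hh : σ (hPoly q k) ^ (q + 1) = hPoly q k ^ (q + 1)) :
    σ (NPoly q k) = NPoly q k := by
  have h1 := congrArg σ (X_zero_pow_mul_NPoly hq hq2 hk)
  simp only [map_mul, map_sub, map_pow, h0, hF, hh] at h1
  rw [← X_zero_pow_mul_NPoly hq hq2 hk] at h1
  exact mul_left_cancel₀ (pow_ne_zero _ (X_ne_zero 0)) h1

theorem NPoly_mem_invariantRing (hq : q = p ^ r) (hq2 : 2 ≤ q) (hk : Fintype.card k = q ^ 2) :
    NPoly q k ∈ invariantRing (HtildeSet q k) := by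
  refine mem_invariantRing_HtildeSet.mpr fun a c h => map_NPoly_eq_self hq hq2 hk _
    (polyAct_htildeMat_X_zero h)
    (mem_invariantRing_HtildeSet.mp (FPoly_mem_invariantRing hq hk) a c h) ?_
  rw [mem_invariantRing_HtildeSet.mp (hPoly_mem_invariantRing hq hk) a c h]

theorem evalGenerators_mem {A : Subalgebra k (MvPolynomial (Fin 3) k)} (h0 : X 0 ∈ A)
    (hF : FPoly q k ∈ A) (hN : NPoly q k ∈ A) (P : MvPolynomial (Fin 3) k) :
    evalGenerators q k P ∈ A := by
  have hle : (evalGenerators q k).range ≤ A := by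
    rw [evalGenerators, ← Algebra.adjoin_range_eq_range_aeval, Algebra.adjoin_le_iff]
    rintro _ ⟨i, rfl⟩
    fin_cases i
    exacts [h0, hF, hN]
  exact hle ⟨P, rfl⟩

theorem polyAct_tauMat_evalGenerators (hq : q = p ^ r) (hq2 : 2 ≤ q)
    (hk : Fintype.card k = q ^ 2) {η : k} (hη : IsPrimitiveRoot η (q + 1))
    (P : MvPolynomial (Fin 3) k) :
    polyAct (tauMat k η) (evalGenerators q k P) = evalGenerators q k P := by
  have hη0 : η ≠ 0 := hη.ne_zero (Nat.succ_ne_zero q)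
  have h0 := polyAct_tauMat_X_zero hη0
  have hF := polyAct_tauMat_FPoly hη0 hη.pow_eq_one
  have hN : polyAct (tauMat k η) (NPoly q k) = NPoly q k := by
    refine map_NPoly_eq_self hq hq2 hk _ h0 hF ?_
    rw [polyAct_tauMat_hPoly hη0 (by rw [← hk]; exact FiniteField.pow_card_sub_one_eq_one η hη0),
      mul_pow, ← C_pow, hη.pow_eq_one, C_1, one_mul]
  exact evalGenerators_mem (A := AlgHom.equalizer (polyAct (tauMat k η)) (AlgHom.id k _))
    h0 hF hN P

/-- Up to a power of `x₁`, every invariant of `H̃` is a polynomial in `x₁`, `F` and `h`. -/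
theorem exists_X_zero_pow_mul_mem_adjoin (hq : q = p ^ r) (hq2 : 2 ≤ q)
    (hk : Fintype.card k = q ^ 2) {f : MvPolynomial (Fin 3) k}
    (hf : f ∈ invariantRing (HtildeSet q k)) :
    ∃ m : ℕ, X 0 ^ m * f ∈ Algebra.adjoin k {X 0, FPoly q k, hPoly q k} := by
  have hq0 : 0 < q := by omega
  set S₁ : Subalgebra k (MvPolynomial (Fin 3) k) := Algebra.adjoin k {X 0, X 1, FPoly q k}
  set S₂ : Subalgebra k (MvPolynomial (Fin 3) k) := Algebra.adjoin k {X 0, FPoly q k, hPoly q k}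
  have hfix : ∀ g ∈ invariantRing (HtildeSet q k), ∀ a c : k, c + c ^ q + a ^ (q + 1) = 0 →
      polyAct (htildeMat q a c) g = g := fun g hg => mem_invariantRing_HtildeSet.mp hg
  have hF := FPoly_mem_invariantRing (k := k) hq hk
  have hX0₁ : X 0 ∈ S₁ := Algebra.subset_adjoin (by simp)
  have hX1₁ : X 1 ∈ S₁ := Algebra.subset_adjoin (by simp)
  have hF₁ : FPoly q k ∈ S₁ := Algebra.subset_adjoin (by simp)
  have hX0₂ : X 0 ∈ S₂ := Algebra.subset_adjoin (by simp)
  have hF₂ : FPoly q k ∈ S₂ := Algebra.subset_adjoin (by simp)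
  have hh₂ : hPoly q k ∈ S₂ := Algebra.subset_adjoin (by simp)
  have hS₂ : S₂ ≤ invariantRing (HtildeSet q k) := by
    rw [Algebra.adjoin_le_iff]
    rintro _ (rfl | rfl | rfl)
    exacts [X_zero_mem_invariantRing, hF, hPoly_mem_invariantRing hq hk]
  obtain ⟨m, hm⟩ : ∃ m : ℕ, X 0 ^ m * f ∈ S₁ := by
    have hpar : ∀ c ∈ htildeFiber q (0 : k), c + c ^ q + 0 ^ (q + 1) = 0 :=
      fun c hc => mem_htildeFiber.mp hc
    refine exists_pow_mul_mem_of_forall_fixed S₁ hq0 (x := X 2) hX0₁ ?_ ?_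
      (I := htildeFiber q (0 : k)) (by simp [card_htildeFiber hq hq2 hk])
      (fun c => polyAct (htildeMat q 0 c)) ?_ (fun c => hfix f hf 0 c (hpar c c.2)) ?_
    · have h1 : (X 0 * X 2 ^ q : MvPolynomial (Fin 3) k) =
          (FPoly q k - X 1 ^ (q + 1)) * X 2 ^ 0 + (-X 0 ^ q) * X 2 ^ 1 := by
        rw [FPoly]
        ring
      rw [h1]
      refine Submodule.add_mem _
        (Submodule.smul_mem _ (⟨_, sub_mem hF₁ (pow_mem hX1₁ _)⟩ : S₁)
          (Submodule.subset_span ⟨⟨0, hq0⟩, rfl⟩))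
        (Submodule.smul_mem _ (⟨_, neg_mem (pow_mem hX0₁ q)⟩ : S₁)
          (Submodule.subset_span ⟨⟨1, hq2⟩, rfl⟩))
    · have htop : (⊤ : Subalgebra k (MvPolynomial (Fin 3) k)) ≤
          (Algebra.adjoin S₁ {(X 2 : MvPolynomial (Fin 3) k)}).restrictScalars k := by
        rw [← MvPolynomial.adjoin_range_X, Algebra.adjoin_le_iff]
        rintro _ ⟨i, rfl⟩
        fin_cases i
        · exact (Algebra.adjoin S₁ _).algebraMap_mem ⟨_, hX0₁⟩
        · exact (Algebra.adjoin S₁ _).algebraMap_mem ⟨_, hX1₁⟩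
        · exact Algebra.self_mem_adjoin_singleton S₁ (X 2)
      exact htop trivial
    · rintro ⟨c, hc⟩ s hs
      have hle : S₁ ≤ AlgHom.equalizer (polyAct (htildeMat q 0 c)) (AlgHom.id k _) := by
        rw [Algebra.adjoin_le_iff]
        rintro _ (rfl | rfl | rfl)
        · exact polyAct_htildeMat_X_zero (hpar c hc)
        · exact (polyAct_htildeMat_X_one (hpar c hc)).trans (by simp)
        · exact hfix _ hF _ _ (hpar c hc)
      exact hle hs
    · rintro ⟨c, hc⟩ ⟨c', hc'⟩ h
      simp only [polyAct_htildeMat_X_two (hpar c hc), polyAct_htildeMat_X_two (hpar c' hc'),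
        add_right_inj] at h
      have h1 : c ^ q = c' ^ q := C_injective _ _ (mul_right_cancel₀ (X_ne_zero 0) h)
      exact Subtype.ext (by linear_combination hpar c hc - hpar c' hc' - h1)
  have hmf : X 0 ^ m * f ∈ invariantRing (HtildeSet q k) :=
    mul_mem (pow_mem X_zero_mem_invariantRing m) hf
  have hex : ∀ a : k, ∃ c : k, c + c ^ q + a ^ (q + 1) = 0 := fun a => by
    obtain ⟨c, hc⟩ : (htildeFiber q a).Nonempty := by
      rw [← Finset.card_pos, card_htildeFiber hq hq2 hk a]
      omega
    exact ⟨c, mem_htildeFiber.mp hc⟩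
  choose c hc using hex
  have hqq : 1 < q ^ 2 := by nlinarith
  obtain ⟨m', hm'⟩ : ∃ m' : ℕ, X 0 ^ m' * (X 0 ^ m * f) ∈ S₂ := by
    refine exists_pow_mul_mem_of_forall_fixed S₂ (n := q ^ 2) (by omega) (x := X 1) hX0₂ ?_ ?_
      hk (fun a => polyAct (htildeMat q a (c a))) (fun a s hs => hfix s (hS₂ hs) a _ (hc a))
      (fun a => hfix _ hmf a _ (hc a)) ?_
    · have h1 : (X 0 * X 1 ^ q ^ 2 : MvPolynomial (Fin 3) k) =
          (X 0 * hPoly q k) * X 1 ^ 0 + (X 0 * X 0 ^ (q ^ 2 - 1)) * X 1 ^ 1 := by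
        rw [hPoly_eq hq0]
        ring
      rw [h1]
      refine Submodule.add_mem _
        (Submodule.smul_mem _ (⟨_, mul_mem hX0₂ hh₂⟩ : S₂)
          (Submodule.subset_span ⟨⟨0, by omega⟩, rfl⟩))
        (Submodule.smul_mem _ (⟨_, mul_mem hX0₂ (pow_mem hX0₂ _)⟩ : S₂)
          (Submodule.subset_span ⟨⟨1, hqq⟩, rfl⟩))
    · have hle : S₁ ≤ (Algebra.adjoin S₂ {(X 1 : MvPolynomial (Fin 3) k)}).restrictScalars k := by
        rw [Algebra.adjoin_le_iff]
        rintro _ (rfl | rfl | rfl)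
        · exact (Algebra.adjoin S₂ _).algebraMap_mem ⟨_, hX0₂⟩
        · exact Algebra.self_mem_adjoin_singleton S₂ (X 1)
        · exact (Algebra.adjoin S₂ _).algebraMap_mem ⟨_, hF₂⟩
      exact hle hm
    · intro a b h
      simp only [polyAct_htildeMat_X_one (hc _), sub_right_inj] at h
      exact C_injective _ _ (mul_right_cancel₀ (X_ne_zero 0) h)
  exact ⟨m' + m, by rwa [pow_add, mul_assoc]⟩

/-- Polynomials in `x₁`, `F`, `N(x₃)` and `h` are combinations of `1, h, …, h ^ q` over
`k[x₁, F, N(x₃)]`. -/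
theorem exists_sum_of_mem_adjoin (hq : q = p ^ r) (hq2 : 2 ≤ q) (hk : Fintype.card k = q ^ 2)
    {f : MvPolynomial (Fin 3) k}
    (hf : f ∈ Algebra.adjoin k {X 0, FPoly q k, NPoly q k, hPoly q k}) :
    ∃ P : Fin (q + 1) → MvPolynomial (Fin 3) k,
      f = ∑ i, evalGenerators q k (P i) * hPoly q k ^ (i : ℕ) := by
  have hX : ∀ i, evalGenerators q k (X i) = ![X 0, FPoly q k, NPoly q k] i := fun i => by
    rw [evalGenerators, aeval_X]
  obtain ⟨G, rfl⟩ : ∃ G : Polynomial (MvPolynomial (Fin 3) k),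
      G.eval₂ (evalGenerators q k).toRingHom (hPoly q k) = f := by
    induction hf using Algebra.adjoin_induction with
    | mem x hx =>
      rcases hx with rfl | rfl | rfl | rfl
      · exact ⟨Polynomial.C (X 0), by simp [hX]⟩
      · exact ⟨Polynomial.C (X 1), by simp [hX]⟩
      · exact ⟨Polynomial.C (X 2), by simp [hX]⟩
      · exact ⟨Polynomial.X, by simp⟩
    | algebraMap a =>
      refine ⟨Polynomial.C (C a), ?_⟩
      rw [Polynomial.eval₂_C]
      exact (evalGenerators q k).commutes a
    | add x y _ _ hx hy =>
      obtain ⟨G, rfl⟩ := hx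
      obtain ⟨G', rfl⟩ := hy
      exact ⟨G + G', Polynomial.eval₂_add _ _⟩
    | mul x y _ _ hx hy =>
      obtain ⟨G, rfl⟩ := hx
      obtain ⟨G', rfl⟩ := hy
      exact ⟨G * G', Polynomial.eval₂_mul _ _⟩
  set M : Polynomial (MvPolynomial (Fin 3) k) := Polynomial.X ^ (q + 1) - Polynomial.C
    (X 1 * (X 1 ^ (q - 1) - X 0 ^ (q ^ 2 - 1)) ^ (q + 1) - X 0 ^ q ^ 2 * X 2) with hM
  have hMmonic : M.Monic := Polynomial.monic_X_pow_sub_C _ (Nat.succ_ne_zero q)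
  have hMdeg : M.degree = (q + 1 : ℕ) := Polynomial.degree_X_pow_sub_C (Nat.succ_pos q) _
  have hMroot : M.eval₂ (evalGenerators q k).toRingHom (hPoly q k) = 0 := by
    have hrel := X_zero_pow_mul_NPoly (k := k) hq hq2 hk
    rw [hM, Polynomial.eval₂_sub, Polynomial.eval₂_X_pow, Polynomial.eval₂_C]
    simp only [map_sub, map_mul, map_pow, AlgHom.toRingHom_eq_coe, RingHom.coe_coe, hX]
    simp only [Matrix.cons_val]
    rw [hrel]
    ring
  refine ⟨fun i => (G %ₘ M).coeff i, ?_⟩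
  have hsum := congrArg (Polynomial.eval₂ (evalGenerators q k).toRingHom (hPoly q k))
    (Polynomial.sum_modByMonic_coeff (p := G) hMmonic hMdeg.le)
  rw [Polynomial.eval₂_modByMonic_eq_self_of_root hMroot, Polynomial.eval₂_finsetSum] at hsum
  simp only [Polynomial.eval₂_monomial] at hsum
  exact hsum.symm

theorem mem_adjoin_of_X_zero_mul_mem (hq : q = p ^ r) (hq2 : 2 ≤ q)
    (hk : Fintype.card k = q ^ 2) {η : k} (hη : IsPrimitiveRoot η (q + 1))
    {f : MvPolynomial (Fin 3) k}
    (hf : X 0 * f ∈ Algebra.adjoin k {X 0, FPoly q k, NPoly q k, hPoly q k}) :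
    f ∈ Algebra.adjoin k {X 0, FPoly q k, NPoly q k, hPoly q k} := by
  have hη0 : η ≠ 0 := hη.ne_zero (Nat.succ_ne_zero q)
  obtain ⟨P, hP⟩ := exists_sum_of_mem_adjoin hq hq2 hk hf
  have hsum : ∑ i, reduceXZero k (evalGenerators q k (P i)) *
      reduceXZero k (hPoly q k) ^ (i : ℕ) = 0 := by
    have h1 := congrArg (reduceXZero k) hP
    simp only [map_mul, map_sum, map_pow] at h1
    rw [← h1]
    simp [reduceXZero]
  have hζ : IsPrimitiveRoot (Polynomial.C (Polynomial.C η)) (q + 1) :=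
    hη.map_of_injective (f := (Polynomial.C : Polynomial k →+* _).comp Polynomial.C)
      (Polynomial.C_injective.comp Polynomial.C_injective)
  have hdvd : ∀ i, X 0 ∣ P i := fun i => by
    refine X_zero_dvd_of_reduceXZero_evalGenerators_eq_zero (by omega : 0 < q) ?_
    refine coeff_eq_zero_of_sum_mul_pow_eq_zero hζ (scaleInner η) (by simp [scaleInner])
      (reduceXZero_hPoly_ne_zero hq2) ?_ _ (fun j => ?_) hsum i
    · rw [scaleInner_reduceXZero hη0, polyAct_tauMat_hPoly hη0
        (by rw [← hk]; exact FiniteField.pow_card_sub_one_eq_one η hη0), map_mul, reduceXZero_C]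
    · rw [scaleInner_reduceXZero hη0, polyAct_tauMat_evalGenerators hq hq2 hk hη]
  choose Q hQ using hdvd
  have hfQ : f = ∑ i, evalGenerators q k (Q i) * hPoly q k ^ (i : ℕ) := by
    refine mul_left_cancel₀ (X_ne_zero (0 : Fin 3)) (hP.trans ?_)
    rw [Finset.mul_sum]
    refine Finset.sum_congr rfl fun i _ => ?_
    have h0 : evalGenerators q k (X 0) = X 0 := by simp [evalGenerators]
    rw [hQ i, map_mul, h0, mul_assoc]
  rw [hfQ]
  refine sum_mem fun i _ => mul_mem (evalGenerators_mem ?_ ?_ ?_ _) (pow_mem ?_ _) <;>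
    exact Algebra.subset_adjoin (by simp)

theorem invariantRing_HtildeSet_eq_adjoin (hq : q = p ^ r) (hq2 : 2 ≤ q)
    (hk : Fintype.card k = q ^ 2) {η : k} (hη : IsPrimitiveRoot η (q + 1)) :
    invariantRing (HtildeSet q k) =
      Algebra.adjoin k {X 0, FPoly q k, NPoly q k, hPoly q k} := by
  refine le_antisymm (fun f hf => ?_) ?_
  · obtain ⟨m, hm⟩ := exists_X_zero_pow_mul_mem_adjoin hq hq2 hk hf
    have hm' : X 0 ^ m * f ∈ Algebra.adjoin k {X 0, FPoly q k, NPoly q k, hPoly q k} :=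
      Algebra.adjoin_mono (by grind) hm
    clear hm
    induction m with
    | zero => simpa using hm'
    | succ m ih =>
      rw [pow_succ', mul_assoc] at hm'
      exact ih (mem_adjoin_of_X_zero_mul_mem hq hq2 hk hη hm')
  · rw [Algebra.adjoin_le_iff]
    rintro _ (rfl | rfl | rfl | rfl)
    exacts [X_zero_mem_invariantRing, FPoly_mem_invariantRing hq hk,
      NPoly_mem_invariantRing hq hq2 hk, hPoly_mem_invariantRing hq hk]

end Invariants

/-- `k[V]^{H̃} = ⊕_{i=0}^{q} k[V]^{H} hⁱ` as a `k[V]^H`-module, where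
`H = ⟨H̃, τ⟩`, and consequently `k[V]^{H̃}` is generated as a `k`-algebra by
`x₁`, `F`, `N(x₃)` and `h`. -/
theorem invariantRing_Htilde_decomposition
    (p r : ℕ) [Fact p.Prime] (hr : 0 < r) (q : ℕ) (hq : q = p ^ r)
    (k : Type) [Field k] [Fintype k] (hk : Fintype.card k = q ^ 2)
    (η : k) (hη : IsPrimitiveRoot η (q + 1)) :
    (∀ f ∈ invariantRing (HtildeSet q k),
      ∃! c : Fin (q + 1) → MvPolynomial (Fin 3) k,
        (∀ i, c i ∈ invariantRing (HtildeSet q k ∪ {tauMat k η})) ∧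
        f = ∑ i : Fin (q + 1), c i * hPoly q k ^ (i : ℕ)) ∧
    invariantRing (HtildeSet q k) =
      Algebra.adjoin k {X 0, FPoly q k, NPoly q k, hPoly q k} := by
  have hprime : p.Prime := Fact.out
  have hq2 : 2 ≤ q := hq ▸ hprime.two_le.trans (Nat.le_self_pow hr.ne' p)
  have hchar : CharP k p :=
    charP_of_card_eq_prime_pow (f := r * 2) (by rw [hk, hq, pow_mul])
  have hgen := invariantRing_HtildeSet_eq_adjoin hq hq2 hk hη
  have hη0 : η ≠ 0 := hη.ne_zero (Nat.succ_ne_zero q)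
  have hτ : ∀ g ∈ invariantRing (HtildeSet q k ∪ {tauMat k η}), polyAct (tauMat k η) g = g :=
    fun g hg => mem_invariantRing.mp hg _ (Or.inr rfl)
  refine ⟨fun f hf => ?_, hgen⟩
  obtain ⟨P, hP⟩ := exists_sum_of_mem_adjoin hq hq2 hk (hgen ▸ hf)
  refine ⟨fun i => evalGenerators q k (P i), ⟨fun i => ?_, hP⟩, ?_⟩
  · rw [mem_invariantRing]
    rintro g (hg | rfl)
    · exact mem_invariantRing.mp (evalGenerators_mem X_zero_mem_invariantRing
        (FPoly_mem_invariantRing hq hk) (NPoly_mem_invariantRing hq hq2 hk) (P i)) g hg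
    · exact polyAct_tauMat_evalGenerators hq hq2 hk hη (P i)
  · rintro c ⟨hc, hsum⟩
    funext i
    refine sub_eq_zero.mp (coeff_eq_zero_of_sum_mul_pow_eq_zero
      (hη.map_of_injective (f := (C : k →+* MvPolynomial (Fin 3) k)) (C_injective _ _))
      (polyAct (tauMat k η) : MvPolynomial (Fin 3) k →+* MvPolynomial (Fin 3) k)
      ((polyAct (tauMat k η)).commutes η) (hPoly_ne_zero hq2)
      (polyAct_tauMat_hPoly hη0 (by rw [← hk]; exact FiniteField.pow_card_sub_one_eq_one η hη0))
      (fun i => c i - evalGenerators q k (P i)) (fun j => ?_) ?_ i)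
    · rw [RingHom.coe_coe, map_sub, hτ _ (hc j), polyAct_tauMat_evalGenerators hq hq2 hk hη]
    · simp only [sub_mul, Finset.sum_sub_distrib]
      rw [← hsum, ← hP, sub_self]
end
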